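/- arXiv:2508.08003 — 6 statements merged into one kernel-verified Lean document; each statement's English description precedes it below -/
import Mathlib

section
/- Let 𝒞 ⊂ ℝ² be a bounded, convex, centrally symmetric region with Lebesgue measure vol(𝒞). Then there exists a constant c > 0 (depending only on 𝒞) such that for all α ≥ 1, the number N(α,𝒞) of integer lattice points in the dilate α·𝒞 satisfies |N(α,𝒞) − α²·vol(𝒞)| ≤ c·α. -/
open Real MeasureTheory Pointwise

lemma Convex.exists_Ioo_subset_subset_Icc {S : Set ℝ} (hS : Convex ℝ S)
    (hb : Bornology.IsBounded S) :
    ∃ a b : ℝ, a ≤ b ∧ Set.Ioo a b ⊆ S ∧ S ⊆ Set.Icc a b := by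
  rcases S.eq_empty_or_nonempty with rfl | hne
  · exact ⟨0, 0, le_rfl, by simp, by simp⟩
  · exact ⟨sInf S, sSup S, csInf_le_csSup hne hb.bddBelow hb.bddAbove,
      IsConnected.Ioo_csInf_csSup_subset ⟨hne, hS.isPreconnected⟩ hb.bddBelow hb.bddAbove,
      subset_Icc_csInf_csSup hb.bddBelow hb.bddAbove⟩

lemma volume_real_eq_of_Ioo_subset_of_subset_Icc {S : Set ℝ} {a b : ℝ} (hab : a ≤ b)
    (h₁ : Set.Ioo a b ⊆ S) (h₂ : S ⊆ Set.Icc a b) : volume.real S = b - a := by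
  apply le_antisymm
  · simpa [Real.volume_real_Icc_of_le hab] using measureReal_mono h₂ (by simp) (μ := volume)
  · have hS : volume S ≠ ⊤ := measure_ne_top_of_subset h₂ (by simp)
    simpa [Real.volume_real_Ioo_of_le hab] using measureReal_mono h₁ hS (μ := volume)

lemma Convex.abs_ncard_int_sub_volume_real_le {S : Set ℝ} (hS : Convex ℝ S)
    (hb : Bornology.IsBounded S) :
    |({n : ℤ | (n : ℝ) ∈ S}.ncard : ℝ) - volume.real S| ≤ 1 := by
  obtain ⟨a, b, hab, h₁, h₂⟩ := hS.exists_Ioo_subset_subset_Icc hb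
  rw [volume_real_eq_of_Ioo_subset_of_subset_Icc hab h₁ h₂]
  have hsub : {n : ℤ | (n : ℝ) ∈ S} ⊆ (Finset.Icc ⌈a⌉ ⌊b⌋ : Finset ℤ) := fun n hn => by
    have := h₂ hn
    simpa [Int.ceil_le, Int.le_floor] using this
  have hsup : ((Finset.Ioo ⌊a⌋ ⌈b⌉ : Finset ℤ) : Set ℤ) ⊆ {n : ℤ | (n : ℝ) ∈ S} := fun n hn => by
    refine h₁ ?_
    simpa [Int.floor_lt, Int.lt_ceil] using hn
  have hle := Set.ncard_le_ncard hsub (Finset.finite_toSet _)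
  have hge := Set.ncard_le_ncard hsup ((Finset.finite_toSet _).subset hsub)
  rw [Set.ncard_coe_finset, Int.card_Icc] at hle
  rw [Set.ncard_coe_finset, Int.card_Ioo] at hge
  set N := {n : ℤ | (n : ℝ) ∈ S}.ncard
  have hceil : ⌈a⌉ ≤ ⌊b⌋ + 1 := by
    rw [Int.ceil_le]
    push_cast
    linarith [Int.lt_floor_add_one b]
  have hle' : (N : ℤ) ≤ ⌊b⌋ + 1 - ⌈a⌉ := by omega
  have hge' : ⌈b⌉ - ⌊a⌋ - 1 ≤ (N : ℤ) := by omega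
  have hleR : (N : ℝ) ≤ ⌊b⌋ + 1 - ⌈a⌉ := by exact_mod_cast hle'
  have hgeR : (⌈b⌉ : ℝ) - ⌊a⌋ - 1 ≤ N := by exact_mod_cast hge'
  rw [abs_le]
  constructor <;> linarith [Int.floor_le a, Int.le_ceil a, Int.floor_le b, Int.le_ceil b]

lemma Convex.prodMk_preimage {K : Set (ℝ × ℝ)} (hK : Convex ℝ K) (x : ℝ) :
    Convex ℝ (Prod.mk x ⁻¹' K) := fun u hu v hv s t hs ht hst => by
  have := hK hu hv hs ht hst
  simpa [← add_mul, hst] using this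

lemma prodMk_preimage_subset_Icc {K : Set (ℝ × ℝ)} {R : ℝ}
    (hKR : K ⊆ Set.Icc (-R) R ×ˢ Set.Icc (-R) R) (x : ℝ) :
    Prod.mk x ⁻¹' K ⊆ Set.Icc (-R) R := fun _ hy => (hKR hy).2

lemma isBounded_prodMk_preimage {K : Set (ℝ × ℝ)} {R : ℝ}
    (hKR : K ⊆ Set.Icc (-R) R ×ˢ Set.Icc (-R) R) (x : ℝ) :
    Bornology.IsBounded (Prod.mk x ⁻¹' K) :=
  (Metric.isBounded_Icc _ _).subset (prodMk_preimage_subset_Icc hKR x)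

/-- The reflected slice over `-y` and the slice over `y` combine to a translate of the latter inside
every slice over `x ∈ [0, y]`. -/
lemma Convex.antitoneOn_volume_real_prodMk_preimage {K : Set (ℝ × ℝ)} {R : ℝ} (hK : Convex ℝ K)
    (hsymm : ∀ x ∈ K, -x ∈ K) (hKR : K ⊆ Set.Icc (-R) R ×ˢ Set.Icc (-R) R) :
    AntitoneOn (fun x => volume.real (Prod.mk x ⁻¹' K)) (Set.Ici 0) := by
  intro x hx y _ hxy
  rcases hxy.eq_or_lt with rfl | hlt
  · exact le_rfl
  have hx : 0 ≤ x := hx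
  have hy : 0 < y := hx.trans_lt hlt
  obtain ⟨a, b, hab, h₁, h₂⟩ :=
    (hK.prodMk_preimage y).exists_Ioo_subset_subset_Icc (isBounded_prodMk_preimage hKR y)
  set c := (y - x) / (2 * y) * (a + b) with hc
  have hsub : Set.Ioo (a - c) (b - c) ⊆ Prod.mk x ⁻¹' K := by
    intro v hv
    have hu : v + c ∈ Set.Ioo a b := ⟨by linarith [hv.1], by linarith [hv.2]⟩
    have hu' : a + b - (v + c) ∈ Set.Ioo a b := ⟨by linarith [hu.2], by linarith [hu.1]⟩
    have key := hK (h₁ hu) (hsymm _ (h₁ hu')) (a := (x + y) / (2 * y)) (b := (y - x) / (2 * y))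
      (by positivity) (div_nonneg (by linarith) (by linarith)) (by field_simp; ring)
    change (x, v) ∈ K
    convert key using 1
    ext
    · simp
      field_simp
      ring
    · simp [hc]
      field_simp
      ring
  have hfin : volume (Prod.mk x ⁻¹' K) ≠ ⊤ :=
    measure_ne_top_of_subset (prodMk_preimage_subset_Icc hKR x) (by simp)
  have := measureReal_mono hsub hfin (μ := volume)
  rw [Real.volume_real_Ioo_of_le (by linarith)] at this
  simp only
  rw [volume_real_eq_of_Ioo_subset_of_subset_Icc hab h₁ h₂]
  linarith

lemma volume_real_prodMk_neg_preimage {K : Set (ℝ × ℝ)} (hsymm : ∀ x ∈ K, -x ∈ K) (x : ℝ) :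
    volume.real (Prod.mk (-x) ⁻¹' K) = volume.real (Prod.mk x ⁻¹' K) := by
  have : Prod.mk (-x) ⁻¹' K = -(Prod.mk x ⁻¹' K) := by
    ext y
    exact ⟨fun h => by simpa using hsymm _ h, fun h => by simpa using hsymm _ h⟩
  rw [this, measureReal_def, Measure.measure_neg, measureReal_def]

lemma abs_sum_int_sub_integral_le {f : ℝ → ℝ} {n : ℕ} (heven : ∀ x, f (-x) = f x)
    (hanti : AntitoneOn f (Set.Ici 0)) (hnonneg : ∀ x, 0 ≤ f x) (hzero : ∀ x, (n : ℝ) < x → f x = 0) :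
    |∑ k ∈ Finset.Icc (-(n : ℤ)) n, f k - ∫ x, f x| ≤ f 0 := by
  have hint : ∫ x, f x = 2 * ∫ x in (0 : ℝ)..n, f x := by
    have habs : ∀ x, f |x| = f x := fun x => by
      rcases abs_choice x with h | h <;> simp [h, heven]
    rw [← integral_congr_ae (Filter.Eventually.of_forall habs), integral_comp_abs,
      intervalIntegral.integral_of_le n.cast_nonneg,
      setIntegral_eq_of_subset_of_forall_sdiff_eq_zero measurableSet_Ioi Set.Ioc_subset_Ioi_self]
    intro x hx
    exact hzero x (by by_contra! h; exact hx.2 ⟨hx.1, h⟩)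
  have hsum : ∑ k ∈ Finset.Icc (-(n : ℤ)) n, f k = 2 * ∑ k ∈ Finset.range (n + 1), f k - f 0 := by
    have := Finset.sum_Icc_of_even_eq_range (f := fun k : ℤ => f k) (fun k => by simp [heven]) n
    simpa using this
  have hanti' : AntitoneOn f (Set.Icc 0 (0 + n)) := hanti.mono fun x hx => hx.1
  have h₁ := hanti'.integral_le_sum
  have h₂ := hanti'.sum_le_integral
  simp only [zero_add] at h₁ h₂
  have h₃ := Finset.sum_range_succ (fun k : ℕ => f k) n
  have h₄ := Finset.sum_range_succ' (fun k : ℕ => f k) n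
  simp only [Nat.cast_zero] at h₄
  rw [hint, hsum, abs_le]
  constructor <;> linarith [hnonneg n, hnonneg 0]

lemma ncard_int_prod_eq_sum {K : Set (ℝ × ℝ)} {n : ℕ}
    (hK : K ⊆ Set.Icc (-(n : ℝ)) n ×ˢ Set.Icc (-(n : ℝ)) n) :
    {p : ℤ × ℤ | ((p.1 : ℝ), (p.2 : ℝ)) ∈ K}.ncard =
      ∑ k ∈ Finset.Icc (-(n : ℤ)) n, {m : ℤ | (m : ℝ) ∈ Prod.mk (k : ℝ) ⁻¹' K}.ncard := by
  classical
  set B := Finset.Icc (-(n : ℤ)) n with hB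
  have hmem : ∀ k m : ℤ, ((k : ℝ), (m : ℝ)) ∈ K → k ∈ B ∧ m ∈ B := fun k m h => by
    have := hK h
    simp only [Set.mem_prod, Set.mem_Icc] at this
    simp only [hB, Finset.mem_Icc]
    exact_mod_cast this
  have h₁ : {p : ℤ × ℤ | ((p.1 : ℝ), (p.2 : ℝ)) ∈ K} =
      ((B ×ˢ B).filter fun p : ℤ × ℤ => ((p.1 : ℝ), (p.2 : ℝ)) ∈ K : Finset (ℤ × ℤ)) := by
    ext p
    simpa using hmem p.1 p.2
  have h₂ : ∀ k : ℤ, {m : ℤ | (m : ℝ) ∈ Prod.mk (k : ℝ) ⁻¹' K} =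
      (B.filter fun m : ℤ => ((k : ℝ), (m : ℝ)) ∈ K : Finset ℤ) := fun k => by
    ext m
    simpa using fun h => (hmem k m h).2
  simp_rw [h₂, h₁, Set.ncard_coe_finset, Finset.card_filter, Finset.sum_product]

/-- Gauss's estimate for a measurable symmetric convex subset of a square. -/
lemma Convex.abs_ncard_sub_volume_real_le {K : Set (ℝ × ℝ)} {R : ℝ} (hK : Convex ℝ K)
    (hmeas : MeasurableSet K) (hsymm : ∀ x ∈ K, -x ∈ K) (hR : 0 ≤ R)
    (hKR : K ⊆ Set.Icc (-R) R ×ˢ Set.Icc (-R) R) :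
    |({p : ℤ × ℤ | ((p.1 : ℝ), (p.2 : ℝ)) ∈ K}.ncard : ℝ) - volume.real K| ≤ 4 * R + 3 := by
  set n := ⌈R⌉₊
  have hRn : R ≤ n := Nat.le_ceil R
  have hnR : (n : ℝ) < R + 1 := Nat.ceil_lt_add_one hR
  have hIcc : Set.Icc (-R) R ⊆ Set.Icc (-(n : ℝ)) n := Set.Icc_subset_Icc (by linarith) hRn
  set f : ℝ → ℝ := fun x => volume.real (Prod.mk x ⁻¹' K) with hf
  have hvol : volume.real K = ∫ x, f x := by
    have hfin : volume K ≠ ⊤ := by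
      refine measure_ne_top_of_subset hKR ?_
      rw [Measure.volume_eq_prod, Measure.prod_prod]
      exact ENNReal.mul_ne_top (by simp) (by simp)
    have := integral_prod (μ := (volume : Measure ℝ)) (ν := (volume : Measure ℝ))
      (K.indicator (1 : ℝ × ℝ → ℝ)) ((integrable_indicator_iff hmeas).2 (integrableOn_const hfin))
    rw [← Measure.volume_eq_prod, integral_indicator_one hmeas] at this
    rw [this]
    refine integral_congr_ae (Filter.Eventually.of_forall fun x => ?_)
    exact integral_indicator_one (measurable_prodMk_left hmeas)
  have hcol : |∑ k ∈ Finset.Icc (-(n : ℤ)) n, f k - ∫ x, f x| ≤ f 0 := by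
    refine abs_sum_int_sub_integral_le (volume_real_prodMk_neg_preimage hsymm)
      (hK.antitoneOn_volume_real_prodMk_preimage hsymm hKR) (fun _ => measureReal_nonneg) ?_
    intro x hx
    have : Prod.mk x ⁻¹' K = ∅ := Set.eq_empty_of_forall_notMem fun y hy => by
      linarith [(hKR hy).1.2]
    simp [hf, this]
  have hf0 : f 0 ≤ 2 * R := by
    have := measureReal_mono (prodMk_preimage_subset_Icc hKR 0) (by simp) (μ := volume)
    rw [Real.volume_real_Icc_of_le (by linarith)] at this
    linarith
  have hcount : |({p : ℤ × ℤ | ((p.1 : ℝ), (p.2 : ℝ)) ∈ K}.ncard : ℝ) -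
      ∑ k ∈ Finset.Icc (-(n : ℤ)) n, f k| ≤ 2 * n + 1 := by
    rw [ncard_int_prod_eq_sum (hKR.trans (Set.prod_mono hIcc hIcc)), Nat.cast_sum,
      ← Finset.sum_sub_distrib]
    refine (Finset.abs_sum_le_sum_abs _ _).trans ((Finset.sum_le_card_nsmul _ _ 1 fun (k : ℤ) _ =>
      (hK.prodMk_preimage (k : ℝ)).abs_ncard_int_sub_volume_real_le
        (isBounded_prodMk_preimage hKR (k : ℝ))).trans ?_)
    have hcard : (Finset.Icc (-(n : ℤ)) n).card = 2 * n + 1 := by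
      rw [Int.card_Icc]
      omega
    simp [hcard]
  rw [hvol]
  have := abs_sub_le ({p : ℤ × ℤ | ((p.1 : ℝ), (p.2 : ℝ)) ∈ K}.ncard : ℝ)
    (∑ k ∈ Finset.Icc (-(n : ℤ)) n, f k) (∫ x, f x)
  linarith

lemma finite_int_prod_mem {K : Set (ℝ × ℝ)} {R : ℝ}
    (hKR : K ⊆ Set.Icc (-R) R ×ˢ Set.Icc (-R) R) :
    {p : ℤ × ℤ | ((p.1 : ℝ), (p.2 : ℝ)) ∈ K}.Finite := by
  refine ((Set.finite_Icc ⌈-R⌉ ⌊R⌋).prod (Set.finite_Icc ⌈-R⌉ ⌊R⌋)).subset fun p hp => ?_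
  have := hKR hp
  simpa only [Set.mem_prod, Set.mem_Icc, Int.ceil_le, Int.le_floor] using this

/-- Convex sets need not be Borel, so the estimate is applied to the interior and the closure,
which have the same volume. -/
lemma Convex.abs_ncard_sub_volume_real_le_of_subset {K : Set (ℝ × ℝ)} {R : ℝ} (hK : Convex ℝ K)
    (hsymm : ∀ x ∈ K, -x ∈ K) (hR : 0 ≤ R) (hKR : K ⊆ Set.Icc (-R) R ×ˢ Set.Icc (-R) R) :
    |({p : ℤ × ℤ | ((p.1 : ℝ), (p.2 : ℝ)) ∈ K}.ncard : ℝ) - volume.real K| ≤ 4 * R + 3 := by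
  have hneg : -K = K := by
    ext x
    exact ⟨fun h => by simpa using hsymm _ h, fun h => hsymm _ h⟩
  have hclR : closure K ⊆ Set.Icc (-R) R ×ˢ Set.Icc (-R) R :=
    closure_minimal hKR (isClosed_Icc.prod isClosed_Icc)
  have hsymm_int : ∀ x ∈ interior K, -x ∈ interior K := fun x hx => by
    have : -interior K = interior K := by
      simpa [hneg] using (Homeomorph.neg (ℝ × ℝ)).preimage_interior K
    rw [← this] at hx
    exact hx
  have hsymm_cl : ∀ x ∈ closure K, -x ∈ closure K := fun x hx => by
    have : -closure K = closure K := by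
      simpa [hneg] using (Homeomorph.neg (ℝ × ℝ)).preimage_closure K
    rw [← this] at hx
    exact hx
  have hint := hK.interior.abs_ncard_sub_volume_real_le isOpen_interior.measurableSet hsymm_int hR
    (interior_subset.trans hKR)
  have hcl := hK.closure.abs_ncard_sub_volume_real_le isClosed_closure.measurableSet hsymm_cl hR hclR
  have hfr : volume (frontier K) = 0 := hK.addHaar_frontier volume
  rw [measureReal_congr (interior_ae_eq_of_null_frontier hfr)] at hint
  rw [measureReal_congr (closure_ae_eq_of_null_frontier hfr)] at hcl
  have h₁ : {p : ℤ × ℤ | ((p.1 : ℝ), (p.2 : ℝ)) ∈ interior K}.ncard ≤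
      {p : ℤ × ℤ | ((p.1 : ℝ), (p.2 : ℝ)) ∈ K}.ncard :=
    Set.ncard_le_ncard (fun p hp => interior_subset (s := K) hp) (finite_int_prod_mem hKR)
  have h₂ : {p : ℤ × ℤ | ((p.1 : ℝ), (p.2 : ℝ)) ∈ K}.ncard ≤
      {p : ℤ × ℤ | ((p.1 : ℝ), (p.2 : ℝ)) ∈ closure K}.ncard :=
    Set.ncard_le_ncard (fun p hp => subset_closure (s := K) hp) (finite_int_prod_mem hclR)
  have h₁' := (Nat.cast_le (α := ℝ)).2 h₁
  have h₂' := (Nat.cast_le (α := ℝ)).2 h₂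
  rw [abs_le] at hint hcl ⊢
  constructor <;> linarith

/-- Gauss lattice-point count in a dilated bounded convex
centrally-symmetric region of the plane. -/
theorem lattice_count_convex (C : Set (ℝ × ℝ)) (hbdd : Bornology.IsBounded C)
    (hconv : Convex ℝ C) (hsymm : ∀ x ∈ C, -x ∈ C) :
    ∃ c : ℝ, 0 < c ∧ ∀ α : ℝ, 1 ≤ α →
      |(({p : ℤ × ℤ | ((p.1 : ℝ), (p.2 : ℝ)) ∈ α • C}).ncard : ℝ) -
          α ^ 2 * (volume C).toReal| ≤ c * α := by
  obtain ⟨r, hr, hC⟩ := hbdd.exists_pos_norm_le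
  refine ⟨4 * r + 3, by positivity, fun α hα => ?_⟩
  have hα₀ : 0 ≤ α := zero_le_one.trans hα
  have hsub : α • C ⊆ Set.Icc (-(α * r)) (α * r) ×ˢ Set.Icc (-(α * r)) (α * r) := by
    rintro _ ⟨x, hx, rfl⟩
    have h := hC x hx
    rw [Prod.norm_def, max_le_iff, Real.norm_eq_abs, Real.norm_eq_abs] at h
    simp only [Set.mem_prod, Set.mem_Icc, ← abs_le, Prod.smul_fst, Prod.smul_snd, smul_eq_mul,
      abs_mul, abs_of_nonneg hα₀]
    exact ⟨mul_le_mul_of_nonneg_left h.1 hα₀, mul_le_mul_of_nonneg_left h.2 hα₀⟩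
  have hsymm' : ∀ x ∈ α • C, -x ∈ α • C := by
    rintro _ ⟨x, hx, rfl⟩
    exact ⟨-x, hsymm x hx, smul_neg α x⟩
  have hmain := (hconv.smul α).abs_ncard_sub_volume_real_le_of_subset hsymm' (by positivity) hsub
  have hvol : volume.real (α • C) = α ^ 2 * (volume C).toReal := by
    rw [measureReal_def, Measure.addHaar_smul_of_nonneg _ hα₀, ENNReal.toReal_mul,
      ENNReal.toReal_ofReal (by positivity)]
    simp
  rw [hvol] at hmain
  linarith
end

section
/- Let 𝒞 ⊂ ℝ² be a bounded, convex, centrally symmetric region with Lebesgue measure vol(𝒞). Then there exists a constant c > 0 (depending only on 𝒞) such that for all α ≥ 2, the number N'(α,𝒞) of primitive integer lattice points in the dilate α·𝒞, i.e., points (a,b) ∈ ℤ² ∩ α·𝒞 with gcd(a,b) = 1, satisfies |N'(α,𝒞) − (6/π²)·α²·vol(𝒞)| ≤ c·α·log α. -/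
open Real MeasureTheory Pointwise

/-- The integer points lying in a planar set. -/
def latticePoints (A : Set (ℝ × ℝ)) : Set (ℤ × ℤ) := {p | ((p.1 : ℝ), (p.2 : ℝ)) ∈ A}

/-- The half-open unit square whose lower left corner is `p`. -/
def unitCell (p : ℤ × ℤ) : Set (ℝ × ℝ) :=
  Set.Ico (p.1 : ℝ) (p.1 + 1) ×ˢ Set.Ico (p.2 : ℝ) (p.2 + 1)

lemma measurableSet_unitCell (p : ℤ × ℤ) : MeasurableSet (unitCell p) :=
  measurableSet_Ico.prod measurableSet_Ico

lemma volume_unitCell (p : ℤ × ℤ) : volume (unitCell p) = 1 := by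
  rw [unitCell, Measure.volume_eq_prod, Measure.prod_prod]
  simp

lemma mem_unitCell_iff {p : ℤ × ℤ} {z : ℝ × ℝ} : z ∈ unitCell p ↔ p = (⌊z.1⌋, ⌊z.2⌋) := by
  rw [unitCell, Set.mem_prod, Set.mem_Ico, Set.mem_Ico, Prod.ext_iff, ← Int.floor_eq_iff,
    ← Int.floor_eq_iff]
  exact and_congr eq_comm eq_comm

lemma norm_sub_lt_one_of_mem_unitCell {p : ℤ × ℤ} {z : ℝ × ℝ} (h : z ∈ unitCell p) :
    ‖z - ((p.1 : ℝ), (p.2 : ℝ))‖ < 1 := by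
  obtain ⟨⟨h1, h2⟩, h3, h4⟩ := h
  rw [Prod.norm_def, max_lt_iff, Real.norm_eq_abs, Real.norm_eq_abs, abs_lt, abs_lt]
  simp only [Prod.fst_sub, Prod.snd_sub]
  constructor <;> constructor <;> linarith

lemma volume_biUnion_unitCell (s : Finset (ℤ × ℤ)) :
    volume (⋃ p ∈ s, unitCell p) = s.card := by
  rw [measure_biUnion_finset _ fun p _ => measurableSet_unitCell p]
  · simp [volume_unitCell]
  · intro p _ q _ hpq
    refine Set.disjoint_left.2 fun z hp hq => hpq ?_
    rw [mem_unitCell_iff.1 hp, mem_unitCell_iff.1 hq]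

lemma finite_latticePoints {A : Set (ℝ × ℝ)} (hA : Bornology.IsBounded A) :
    (latticePoints A).Finite := by
  obtain ⟨R, hR⟩ := hA.exists_norm_le
  refine ((Set.finite_Icc (-⌈R⌉) ⌈R⌉).prod (Set.finite_Icc (-⌈R⌉) ⌈R⌉)).subset fun p hp => ?_
  have h := hR _ hp
  rw [Prod.norm_def, max_le_iff, Real.norm_eq_abs, Real.norm_eq_abs, abs_le, abs_le] at h
  have hc := Int.le_ceil R
  obtain ⟨⟨h1, h2⟩, h3, h4⟩ := h
  simp only [Set.mem_prod, Set.mem_Icc]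
  refine ⟨⟨?_, ?_⟩, ?_, ?_⟩ <;> (rify; linarith)

lemma ncard_latticePoints_le_volume {A B : Set (ℝ × ℝ)} (hA : Bornology.IsBounded A)
    (hB : Bornology.IsBounded B) (h : ∀ x ∈ A, ∀ y, ‖y‖ < 1 → x + y ∈ B) :
    ((latticePoints A).ncard : ℝ) ≤ (volume B).toReal := by
  rw [Set.ncard_eq_toFinset_card _ (finite_latticePoints hA), ← ENNReal.toReal_natCast,
    ← volume_biUnion_unitCell]
  refine ENNReal.toReal_mono hB.measure_lt_top.ne (measure_mono ?_)
  refine Set.iUnion₂_subset fun p hp z hz => ?_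
  rw [Set.Finite.mem_toFinset] at hp
  simpa using h _ hp _ (norm_sub_lt_one_of_mem_unitCell hz)

lemma volume_le_ncard_latticePoints {A B : Set (ℝ × ℝ)} (hA : Bornology.IsBounded A)
    (h : ∀ x ∈ B, ∀ y, ‖y‖ < 1 → x + y ∈ A) :
    (volume B).toReal ≤ (latticePoints A).ncard := by
  rw [Set.ncard_eq_toFinset_card _ (finite_latticePoints hA), ← ENNReal.toReal_natCast,
    ← volume_biUnion_unitCell]
  refine ENNReal.toReal_mono ?_ (measure_mono fun z hz => ?_)
  · rw [volume_biUnion_unitCell]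
    exact ENNReal.natCast_ne_top _
  · have hc : z ∈ unitCell (⌊z.1⌋, ⌊z.2⌋) := mem_unitCell_iff.2 rfl
    refine Set.mem_biUnion ?_ hc
    rw [SetLike.mem_coe, Set.Finite.mem_toFinset]
    have := h z hz _ ((norm_neg _).trans_lt (norm_sub_lt_one_of_mem_unitCell hc))
    simpa [latticePoints] using this

lemma toReal_volume_smul {β : ℝ} (C : Set (ℝ × ℝ)) :
    (volume (β • C)).toReal = β ^ 2 * (volume C).toReal := by
  rw [Measure.addHaar_smul, ENNReal.toReal_mul, ENNReal.toReal_ofReal (abs_nonneg _)]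
  simp

lemma add_mem_smul_of_norm_lt {C : Set (ℝ × ℝ)} (hconv : Convex ℝ C) {s : ℝ} (hs : 0 < s)
    (hball : Metric.ball 0 s⁻¹ ⊆ C) {β : ℝ} (hβ : 0 ≤ β) {x y : ℝ × ℝ}
    (hx : x ∈ β • C) (hy : ‖y‖ < 1) : x + y ∈ (β + s) • C := by
  rw [hconv.add_smul hβ hs.le]
  refine Set.add_mem_add hx ?_
  rw [Set.mem_smul_set_iff_inv_smul_mem₀ hs.ne']
  apply hball
  rw [mem_ball_zero_iff, norm_smul, Real.norm_of_nonneg (inv_nonneg.2 hs.le)]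
  exact mul_lt_of_lt_one_right (inv_pos.2 hs) hy

/-- A dilate of a planar convex body `C` contains about as many lattice points as its area, with an
error of the order of its perimeter. -/
lemma abs_ncard_latticePoints_smul_sub_le {C : Set (ℝ × ℝ)} (hbdd : Bornology.IsBounded C)
    (hconv : Convex ℝ C) {s : ℝ} (hs : 0 < s) (hball : Metric.ball 0 s⁻¹ ⊆ C) {β : ℝ}
    (hβ : 0 ≤ β) :
    |((latticePoints (β • C)).ncard : ℝ) - β ^ 2 * (volume C).toReal| ≤
      (2 * β * s + s ^ 2) * (volume C).toReal := by
  have hV : 0 ≤ (volume C).toReal := ENNReal.toReal_nonneg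
  have hup := ncard_latticePoints_le_volume (hbdd.smul₀ β) (hbdd.smul₀ (β + s))
    fun x hx y hy => add_mem_smul_of_norm_lt hconv hs hball hβ hx hy
  rw [toReal_volume_smul] at hup
  rw [abs_le]
  refine ⟨?_, by linarith⟩
  rcases le_total s β with hsβ | hsβ
  · have hlow := volume_le_ncard_latticePoints (hbdd.smul₀ β) (B := (β - s) • C)
      fun x hx y hy => by
        simpa using add_mem_smul_of_norm_lt hconv hs hball (sub_nonneg.2 hsβ) hx hy
    rw [toReal_volume_smul] at hlow
    nlinarith [mul_nonneg (sq_nonneg s) hV]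
  · have h0 : (0 : ℝ) ≤ (latticePoints (β • C)).ncard := Nat.cast_nonneg _
    have h1 : 0 ≤ (2 * β * s + s ^ 2 - β ^ 2) * (volume C).toReal :=
      mul_nonneg (by nlinarith) hV
    linarith

lemma exists_ball_subset {C : Set (ℝ × ℝ)} (hconv : Convex ℝ C) (hsymm : ∀ x ∈ C, -x ∈ C)
    (hne : (interior C).Nonempty) : ∃ s : ℝ, 0 < s ∧ Metric.ball 0 s⁻¹ ⊆ C := by
  obtain ⟨x, hx⟩ := hne
  have hx' : -x ∈ interior C := by
    rw [mem_interior_iff_mem_nhds] at hx ⊢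
    filter_upwards [continuous_neg.tendsto' (-x) x (neg_neg x) hx] with y hy
    simpa using hsymm _ hy
  have h0 : (0 : ℝ × ℝ) ∈ interior C := by
    simpa using hconv.interior hx hx' (by norm_num : (0 : ℝ) ≤ 1 / 2)
      (by norm_num : (0 : ℝ) ≤ 1 / 2) (by norm_num)
  obtain ⟨r, hr, hball⟩ := Metric.mem_nhds_iff.1 (mem_interior_iff_mem_nhds.1 h0)
  exact ⟨r⁻¹, inv_pos.2 hr, by simpa using hball⟩

section moebius
open ArithmeticFunction ArithmeticFunction.Moebius ArithmeticFunction.zeta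

lemma sum_Icc_moebius_filter_dvd {g D : ℕ} (hg : g ≠ 0) (hD : g ≤ D) :
    ∑ d ∈ Finset.Icc 1 D with d ∣ g, (μ d : ℝ) = if g = 1 then 1 else 0 := by
  have h : (Finset.Icc 1 D).filter (· ∣ g) = g.divisors := by
    ext d
    simp only [Finset.mem_filter, Finset.mem_Icc, Nat.mem_divisors]
    constructor
    · exact fun h => ⟨h.2, hg⟩
    · exact fun h => ⟨⟨Nat.pos_of_dvd_of_pos h.1 (Nat.pos_of_ne_zero hg),
        (Nat.le_of_dvd (Nat.pos_of_ne_zero hg) h.1).trans hD⟩, h.1⟩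
  have h1 := congrArg (fun f : ArithmeticFunction ℤ => f g) coe_zeta_mul_moebius
  simp only [coe_zeta_mul_apply, one_apply] at h1
  rw [h]
  exact_mod_cast h1

lemma card_filter_eq_one_eq_sum_moebius {ι : Type*} (W : Finset ι) (g : ι → ℕ) {D : ℕ}
    (hg : ∀ p ∈ W, g p ≠ 0 ∧ g p ≤ D) :
    ((W.filter (g · = 1)).card : ℝ) =
      ∑ d ∈ Finset.Icc 1 D, (μ d : ℝ) * (W.filter (d ∣ g ·)).card := by
  simp only [Finset.card_filter, Nat.cast_sum, Finset.mul_sum]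
  rw [Finset.sum_comm]
  refine Finset.sum_congr rfl fun p hp => ?_
  rw [← Nat.cast_one, ← Nat.cast_zero]
  have := sum_Icc_moebius_filter_dvd (hg p hp).1 (hg p hp).2
  rw [Finset.sum_filter] at this
  push_cast
  rw [← this]
  simp

lemma hasSum_moebius_div_sq : HasSum (fun d : ℕ => (μ d : ℝ) / d ^ 2) (6 / π ^ 2) := by
  have h2 : 1 < (2 : ℂ).re := by norm_num
  have hsum := (LSeriesSummable_moebius_iff.2 h2).LSeriesHasSum
  have hval : LSeries (fun n => ((μ n : ℤ) : ℂ)) 2 = ((6 / π ^ 2 : ℝ) : ℂ) := by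
    have h := LSeries_one_mul_Lseries_moebius h2
    rw [LSeries_one_eq_riemannZeta h2, riemannZeta_two] at h
    have hpi : (π : ℂ) ≠ 0 := by exact_mod_cast pi_ne_zero
    push_cast
    rw [eq_div_iff (pow_ne_zero 2 hpi)]
    linear_combination 6 * h
  rw [LSeriesHasSum, hval] at hsum
  rw [← Complex.hasSum_ofReal]
  convert hsum using 2 with d
  rcases eq_or_ne d 0 with rfl | hd
  · simp
  · rw [LSeries.term_of_ne_zero hd]
    push_cast
    norm_cast

lemma abs_sum_moebius_div_sq_sub_le (D : ℕ) :
    |(∑ d ∈ Finset.Icc 1 D, (μ d : ℝ) / (d : ℝ) ^ 2) - 6 / π ^ 2| ≤ 2 / ((D : ℝ) + 1) := by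
  have hlim := hasSum_moebius_div_sq.tendsto_sum_nat
  rw [abs_sub_comm]
  refine le_of_tendsto ((hlim.sub_const _).abs) ?_
  filter_upwards [Filter.eventually_ge_atTop (D + 1)] with n hn
  have hsplit : ∑ d ∈ Finset.range n, (μ d : ℝ) / d ^ 2 -
      ∑ d ∈ Finset.Icc 1 D, (μ d : ℝ) / d ^ 2 = ∑ d ∈ Finset.Ioo D n, (μ d : ℝ) / d ^ 2 := by
    rw [sub_eq_iff_eq_add, add_comm, Finset.range_eq_Ico,
      ← Finset.sum_Ico_consecutive _ (Nat.zero_le (D + 1)) hn,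
      Finset.sum_eq_sum_Ico_succ_bot (Nat.succ_pos D)]
    simp only [Nat.cast_zero, ArithmeticFunction.map_zero, Int.cast_zero, zero_div, zero_add]
    rfl
  rw [hsplit]
  refine (Finset.abs_sum_le_sum_abs _ _).trans
    ((Finset.sum_le_sum fun d _ => ?_).trans (sum_Ioo_inv_sq_le D n))
  rw [abs_div, abs_of_nonneg (sq_nonneg (d : ℝ)), div_eq_mul_inv]
  refine mul_le_of_le_one_left (by positivity) ?_
  exact_mod_cast abs_moebius_le_one

end moebius

lemma mem_latticePoints_div_smul_iff {C : Set (ℝ × ℝ)} {α : ℝ} {d : ℕ} (hd : d ≠ 0)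
    (p : ℤ × ℤ) :
    p ∈ latticePoints ((α / d) • C) ↔ ((d : ℤ) * p.1, (d : ℤ) * p.2) ∈ latticePoints (α • C) := by
  have hd' : (d : ℝ) ≠ 0 := Nat.cast_ne_zero.2 hd
  have h : α • C = (d : ℝ) • ((α / d) • C) := by rw [smul_smul, mul_div_cancel₀ _ hd']
  rw [h]
  simp only [latticePoints, Set.mem_ofPred_eq]
  rw [← Set.smul_mem_smul_set_iff₀ hd']
  simp

lemma card_filter_dvd_gcd_latticePoints {C : Set (ℝ × ℝ)} (hbdd : Bornology.IsBounded C)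
    (h0 : (0 : ℝ × ℝ) ∈ C) {α : ℝ} {d : ℕ} (hd : d ≠ 0) :
    ((((finite_latticePoints (hbdd.smul₀ α)).toFinset.erase 0).filter
      (fun p => d ∣ Int.gcd p.1 p.2)).card : ℝ) =
      ((latticePoints ((α / d) • C)).ncard : ℝ) - 1 := by
  have hdz : (d : ℤ) ≠ 0 := Nat.cast_ne_zero.2 hd
  have hmem : (0 : ℤ × ℤ) ∈ (finite_latticePoints (hbdd.smul₀ (α / d))).toFinset := by
    rw [Set.Finite.mem_toFinset]
    exact ⟨0, h0, by ext <;> simp⟩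
  have himage : ((finite_latticePoints (hbdd.smul₀ α)).toFinset.erase 0).filter
      (fun p => d ∣ Int.gcd p.1 p.2) =
      ((finite_latticePoints (hbdd.smul₀ (α / d))).toFinset.erase 0).image
        (fun p => ((d : ℤ) * p.1, (d : ℤ) * p.2)) := by
    ext p
    simp only [Finset.mem_filter, Finset.mem_erase, Set.Finite.mem_toFinset, Finset.mem_image]
    constructor
    · rintro ⟨⟨hp, hpC⟩, hdvd⟩
      rw [← Int.natCast_dvd_natCast, Int.dvd_coe_gcd_iff] at hdvd
      obtain ⟨⟨a, ha⟩, b, hb⟩ := hdvd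
      have hab : ((d : ℤ) * a, (d : ℤ) * b) = p := Prod.ext ha.symm hb.symm
      refine ⟨(a, b), ⟨?_, (mem_latticePoints_div_smul_iff hd _).2 (hab ▸ hpC)⟩, hab⟩
      intro h
      rw [Prod.mk_eq_zero] at h
      exact hp (by rw [← hab, h.1, h.2, mul_zero]; rfl)
    · rintro ⟨q, ⟨hq, hqC⟩, rfl⟩
      refine ⟨⟨?_, (mem_latticePoints_div_smul_iff hd _).1 hqC⟩, ?_⟩
      · simpa [Prod.ext_iff, hdz, hd] using hq
      · rw [← Int.natCast_dvd_natCast, Int.dvd_coe_gcd_iff]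
        exact ⟨dvd_mul_right _ _, dvd_mul_right _ _⟩
  rw [himage, Finset.card_image_of_injective, Finset.cast_card_erase_of_mem hmem,
    ← Set.ncard_eq_toFinset_card _ (finite_latticePoints (hbdd.smul₀ (α / d)))]
  intro p q hpq
  simpa [Prod.ext_iff, hdz, hd] using hpq

lemma gcd_le_of_mem_latticePoints {C : Set (ℝ × ℝ)} {R α : ℝ} (hR : ∀ x ∈ C, ‖x‖ ≤ R)
    (hα : 0 ≤ α) {p : ℤ × ℤ} (hp : p ∈ latticePoints (α • C)) (hp0 : p ≠ 0) :
    (Int.gcd p.1 p.2 : ℝ) ≤ α * R := by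
  obtain ⟨x, hx, hxp⟩ := hp
  have hnorm : ‖((p.1 : ℝ), (p.2 : ℝ))‖ ≤ α * R := by
    rw [← hxp]
    simp only [norm_smul, Real.norm_of_nonneg hα]
    exact mul_le_mul_of_nonneg_left (hR x hx) hα
  rw [Prod.norm_def, max_le_iff, Real.norm_eq_abs, Real.norm_eq_abs, ← Int.cast_abs,
    ← Int.cast_abs, Int.abs_eq_natAbs, Int.abs_eq_natAbs] at hnorm
  simp only [Int.cast_natCast] at hnorm
  by_cases h1 : p.1 = 0
  · have h2 : p.2 ≠ 0 := fun h2 => hp0 (Prod.ext h1 h2)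
    refine le_trans ?_ hnorm.2
    exact_mod_cast Nat.le_of_dvd (Int.natAbs_pos.2 h2) (Int.gcd_dvd_natAbs_right _ _)
  · refine le_trans ?_ hnorm.1
    exact_mod_cast Nat.le_of_dvd (Int.natAbs_pos.2 h1) (Int.gcd_dvd_natAbs_left _ _)

section moebius
open ArithmeticFunction.Moebius

lemma ncard_primitive_eq_sum_moebius {C : Set (ℝ × ℝ)} (hbdd : Bornology.IsBounded C)
    (h0 : (0 : ℝ × ℝ) ∈ C) {R α : ℝ} (hR : ∀ x ∈ C, ‖x‖ ≤ R) (hα : 0 ≤ α) :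
    (({p : ℤ × ℤ | Int.gcd p.1 p.2 = 1 ∧ ((p.1 : ℝ), (p.2 : ℝ)) ∈ α • C}).ncard : ℝ) =
      ∑ d ∈ Finset.Icc 1 ⌊α * R⌋₊,
        (μ d : ℝ) * (((latticePoints ((α / d) • C)).ncard : ℝ) - 1) := by
  have hset : {p : ℤ × ℤ | Int.gcd p.1 p.2 = 1 ∧ ((p.1 : ℝ), (p.2 : ℝ)) ∈ α • C} =
      (((finite_latticePoints (hbdd.smul₀ α)).toFinset.erase 0).filter
        (fun p => Int.gcd p.1 p.2 = 1) : Finset (ℤ × ℤ)) := by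
    ext p
    simp only [Finset.coe_filter, Finset.mem_erase, Set.Finite.mem_toFinset, Set.mem_ofPred_eq]
    constructor
    · rintro ⟨h1, h2⟩
      refine ⟨⟨?_, h2⟩, h1⟩
      rintro rfl
      simp at h1
    · exact fun h => ⟨h.2, h.1.2⟩
  rw [hset, Set.ncard_coe_finset, card_filter_eq_one_eq_sum_moebius (D := ⌊α * R⌋₊)]
  · refine Finset.sum_congr rfl fun d hd => ?_
    rw [card_filter_dvd_gcd_latticePoints hbdd h0
      (Nat.one_le_iff_ne_zero.1 (Finset.mem_Icc.1 hd).1)]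
  · intro p hp
    rw [Finset.mem_erase, Set.Finite.mem_toFinset] at hp
    refine ⟨fun h => hp.1 ?_, Nat.le_floor (gcd_le_of_mem_latticePoints hR hα hp.2 hp.1)⟩
    rw [Int.gcd_eq_zero_iff] at h
    exact Prod.ext h.1 h.2

/-- Möbius inversion turns a linear error term for all lattice points into an `α log α` error term
for the primitive ones. -/
lemma primitive_count_of_lattice_count {C : Set (ℝ × ℝ)} (hbdd : Bornology.IsBounded C)
    (h0 : (0 : ℝ × ℝ) ∈ C) {K V : ℝ} (hV : 0 ≤ V) (hK : 0 ≤ K)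
    (hcount : ∀ β : ℝ, 0 ≤ β →
      |((latticePoints (β • C)).ncard : ℝ) - 1 - β ^ 2 * V| ≤ K * (β + 1)) :
    ∃ c : ℝ, 0 < c ∧ ∀ α : ℝ, 2 ≤ α →
      |(({p : ℤ × ℤ | Int.gcd p.1 p.2 = 1 ∧ ((p.1 : ℝ), (p.2 : ℝ)) ∈ α • C}).ncard : ℝ) -
          (6 / π ^ 2) * α ^ 2 * V| ≤ c * α * Real.log α := by
  obtain ⟨R₀, hR₀⟩ := hbdd.exists_norm_le
  obtain ⟨R, hR1, hR⟩ : ∃ R : ℝ, 1 ≤ R ∧ ∀ x ∈ C, ‖x‖ ≤ R :=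
    ⟨max 1 R₀, le_max_left _ _, fun x hx => (hR₀ x hx).trans (le_max_right _ _)⟩
  have hlogR : 0 ≤ Real.log R := Real.log_nonneg hR1
  refine ⟨4 * V + K * (3 + 2 * Real.log R + 2 * R) + 1, by positivity, fun α hα => ?_⟩
  have hα0 : 0 < α := by linarith
  have hlog : 1 ≤ 2 * Real.log α := by
    have := Real.log_le_log (by norm_num) hα
    have := Real.log_two_gt_d9
    linarith
  rw [ncard_primitive_eq_sum_moebius hbdd h0 hR hα0.le]
  set D := ⌊α * R⌋₊ with hD
  have hDle : (D : ℝ) ≤ α * R := Nat.floor_le (by positivity)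
  have hDlt : α * R < D + 1 := Nat.lt_floor_add_one _
  have hαR : α ≤ α * R := le_mul_of_one_le_right hα0.le hR1
  have hD1 : (1 : ℝ) ≤ D := by
    have : 1 ≤ D := Nat.le_floor (by push_cast; linarith)
    exact_mod_cast this
  have hharm : ∑ d ∈ Finset.Icc 1 D, (d : ℝ)⁻¹ ≤ 1 + (Real.log α + Real.log R) := by
    have h := harmonic_le_one_add_log D
    rw [harmonic_eq_sum_Icc] at h
    push_cast at h
    rw [← Real.log_mul hα0.ne' (by positivity)]
    exact h.trans (by gcongr)
  have herr : |∑ d ∈ Finset.Icc 1 D, (μ d : ℝ) *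
      (((latticePoints ((α / d) • C)).ncard : ℝ) - 1 - (α / d) ^ 2 * V)| ≤
      K * (α * (1 + (Real.log α + Real.log R)) + α * R) := by
    calc _ ≤ ∑ d ∈ Finset.Icc 1 D, K * (α * (d : ℝ)⁻¹ + 1) := by
          refine (Finset.abs_sum_le_sum_abs _ _).trans (Finset.sum_le_sum fun d _ => ?_)
          rw [abs_mul]
          have h1 : |(μ d : ℝ)| ≤ 1 := by
            exact_mod_cast ArithmeticFunction.abs_moebius_le_one
          exact (mul_le_of_le_one_left (abs_nonneg _) h1).trans
            (hcount (α / d) (by positivity))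
      _ = K * (α * ∑ d ∈ Finset.Icc 1 D, (d : ℝ)⁻¹ + D) := by
          rw [← Finset.mul_sum, Finset.sum_add_distrib, ← Finset.mul_sum]
          simp
      _ ≤ _ := by gcongr
  have hmain : |((∑ d ∈ Finset.Icc 1 D, (μ d : ℝ) / (d : ℝ) ^ 2) - 6 / π ^ 2) * (α ^ 2 * V)| ≤
      2 * α * V := by
    rw [abs_mul, abs_of_nonneg (by positivity : 0 ≤ α ^ 2 * V)]
    calc _ ≤ 2 / ((D : ℝ) + 1) * (α ^ 2 * V) := by
          gcongr
          exact abs_sum_moebius_div_sq_sub_le D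
      _ ≤ 2 / α * (α ^ 2 * V) := by
          gcongr
          linarith
      _ = 2 * α * V := by field_simp
  have hsplit : ∑ d ∈ Finset.Icc 1 D,
        (μ d : ℝ) * (((latticePoints ((α / d) • C)).ncard : ℝ) - 1) - 6 / π ^ 2 * α ^ 2 * V =
      ∑ d ∈ Finset.Icc 1 D, (μ d : ℝ) *
        (((latticePoints ((α / d) • C)).ncard : ℝ) - 1 - (α / d) ^ 2 * V) +
      ((∑ d ∈ Finset.Icc 1 D, (μ d : ℝ) / (d : ℝ) ^ 2) - 6 / π ^ 2) * (α ^ 2 * V) := by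
    rw [sub_mul, Finset.sum_mul, ← add_sub_assoc, ← Finset.sum_add_distrib]
    congr 1
    · refine Finset.sum_congr rfl fun d _ => ?_
      ring
    · ring
  rw [hsplit]
  refine (abs_add_le _ _).trans ((add_le_add herr hmain).trans ?_)
  have e1 : 0 ≤ α * V * (2 * Real.log α - 1) := by
    have := sub_nonneg.2 hlog
    positivity
  have e2 : 0 ≤ α * K * (1 + Real.log R + R) * (2 * Real.log α - 1) := by
    have := sub_nonneg.2 hlog
    positivity
  have e3 : 0 ≤ α * Real.log α := mul_nonneg hα0.le (by linarith)
  linarith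

end moebius

lemma interior_nonempty_of_det_ne_zero {C : Set (ℝ × ℝ)} (hconv : Convex ℝ C)
    (h0 : (0 : ℝ × ℝ) ∈ C) {x y : ℝ × ℝ} (hx : x ∈ C) (hy : y ∈ C)
    (hdet : x.1 * y.2 - x.2 * y.1 ≠ 0) : (interior C).Nonempty := by
  let L : ℝ × ℝ →ₗ[ℝ] ℝ × ℝ :=
    (LinearMap.fst ℝ ℝ ℝ).smulRight x + (LinearMap.snd ℝ ℝ ℝ).smulRight y
  have hL : ∀ u, L u = u.1 • x + u.2 • y := fun u => rfl
  have hsurj : Function.Surjective L := fun z => by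
    refine ⟨((z.1 * y.2 - z.2 * y.1) / (x.1 * y.2 - x.2 * y.1),
      (x.1 * z.2 - x.2 * z.1) / (x.1 * y.2 - x.2 * y.1)), ?_⟩
    rw [hL]
    ext
    · simp only [Prod.fst_add, Prod.smul_fst, smul_eq_mul]
      rw [div_mul_eq_mul_div, div_mul_eq_mul_div, ← add_div, div_eq_iff hdet]
      ring
    · simp only [Prod.snd_add, Prod.smul_snd, smul_eq_mul]
      rw [div_mul_eq_mul_div, div_mul_eq_mul_div, ← add_div, div_eq_iff hdet]
      ring
  let U : Set (ℝ × ℝ) := Set.Ioo 0 (1 / 2) ×ˢ Set.Ioo 0 (1 / 2)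
  have hU : IsOpen U := isOpen_Ioo.prod isOpen_Ioo
  have hsub : L '' U ⊆ C := by
    rintro _ ⟨u, ⟨⟨h1, h2⟩, h3, h4⟩, rfl⟩
    rw [hL]
    have hsmul := hconv.sum_mem (t := Finset.univ)
      (w := ![u.1, u.2, 1 - u.1 - u.2]) (z := ![x, y, 0])
      (by
        intro i _
        fin_cases i
        · exact h1.le
        · exact h3.le
        · simp only [Fin.reduceFinMk, Matrix.cons_val]; linarith)
      (by simp [Fin.sum_univ_three])
      (by
        intro i _
        fin_cases i
        · exact hx
        · exact hy
        · exact h0)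
    simpa [Fin.sum_univ_three] using hsmul
  refine ⟨L (1 / 4, 1 / 4), interior_maximal hsub
    (L.isOpenMap_of_finiteDimensional hsurj U hU) ⟨_, ?_, rfl⟩⟩
  constructor <;> constructor <;> norm_num

lemma natAbs_eq_of_isCoprime_of_mul_eq {a b c d : ℤ} (hab : IsCoprime a b) (hcd : IsCoprime c d)
    (h : a * d = b * c) : a.natAbs = c.natAbs ∧ b.natAbs = d.natAbs := by
  constructor
  · refine Int.natAbs_eq_of_dvd_dvd (hab.dvd_of_dvd_mul_left ⟨d, h.symm⟩) ?_
    exact hcd.dvd_of_dvd_mul_right ⟨b, by rw [h, mul_comm]⟩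
  · refine Int.natAbs_eq_of_dvd_dvd (hab.symm.dvd_of_dvd_mul_left ⟨c, h⟩) ?_
    exact hcd.symm.dvd_of_dvd_mul_right ⟨a, by rw [← h, mul_comm]⟩

lemma ncard_primitive_le_four_of_det_eq_zero {A : Set (ℝ × ℝ)}
    (hdet : ∀ x ∈ A, ∀ y ∈ A, x.1 * y.2 - x.2 * y.1 = 0) :
    ({p : ℤ × ℤ | Int.gcd p.1 p.2 = 1 ∧ ((p.1 : ℝ), (p.2 : ℝ)) ∈ A}).ncard ≤ 4 := by
  set S := {p : ℤ × ℤ | Int.gcd p.1 p.2 = 1 ∧ ((p.1 : ℝ), (p.2 : ℝ)) ∈ A}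
  rcases S.eq_empty_or_nonempty with hS | ⟨p, hp⟩
  · simp [hS]
  · have hsub : S ⊆ (({p.1, -p.1} ×ˢ {p.2, -p.2} : Finset (ℤ × ℤ)) : Set (ℤ × ℤ)) := by
      intro q hq
      have h := hdet _ hp.2 _ hq.2
      have hz : p.1 * q.2 = p.2 * q.1 := by
        have : (p.1 : ℝ) * q.2 = p.2 * q.1 := sub_eq_zero.1 h
        exact_mod_cast this
      obtain ⟨h1, h2⟩ := natAbs_eq_of_isCoprime_of_mul_eq
        (Int.isCoprime_iff_gcd_eq_one.2 hp.1) (Int.isCoprime_iff_gcd_eq_one.2 hq.1) hz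
      rw [Finset.mem_coe, Finset.mem_product]
      simp only [Finset.mem_insert, Finset.mem_singleton]
      exact ⟨Int.natAbs_eq_natAbs_iff.1 h1.symm, Int.natAbs_eq_natAbs_iff.1 h2.symm⟩
    refine (Set.ncard_le_ncard hsub (Finset.finite_toSet _)).trans ?_
    rw [Set.ncard_coe_finset, Finset.card_product]
    exact Nat.mul_le_mul Finset.card_le_two Finset.card_le_two

lemma ncard_primitive_smul_le_four_of_interior_eq_empty {C : Set (ℝ × ℝ)} (hconv : Convex ℝ C)
    (hsymm : ∀ x ∈ C, -x ∈ C) (hint : ¬(interior C).Nonempty) (α : ℝ) :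
    ({p : ℤ × ℤ | Int.gcd p.1 p.2 = 1 ∧ ((p.1 : ℝ), (p.2 : ℝ)) ∈ α • C}).ncard ≤ 4 := by
  refine ncard_primitive_le_four_of_det_eq_zero ?_
  rintro _ ⟨x, hx, rfl⟩ _ ⟨y, hy, rfl⟩
  have h0 : (0 : ℝ × ℝ) ∈ C := by
    simpa using hconv hx (hsymm x hx) (by norm_num : (0 : ℝ) ≤ 1 / 2)
      (by norm_num : (0 : ℝ) ≤ 1 / 2) (by norm_num)
  have hdet : x.1 * y.2 - x.2 * y.1 = 0 := by
    by_contra h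
    exact hint (interior_nonempty_of_det_ne_zero hconv h0 hx hy h)
  simp only [Prod.smul_fst, Prod.smul_snd, smul_eq_mul]
  linear_combination α ^ 2 * hdet

lemma volume_eq_zero_of_interior_eq_empty {C : Set (ℝ × ℝ)} (hconv : Convex ℝ C)
    (hint : ¬(interior C).Nonempty) : volume C = 0 := by
  refine measure_mono_null ?_ (hconv.addHaar_frontier volume)
  rw [frontier, Set.not_nonempty_iff_eq_empty.1 hint, Set.sdiff_empty]
  exact subset_closure

/-- count of primitive lattice points in a dilated bounded convex
centrally-symmetric region of the plane. -/
theorem primitive_lattice_count_convex (C : Set (ℝ × ℝ)) (hbdd : Bornology.IsBounded C)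
    (hconv : Convex ℝ C) (hsymm : ∀ x ∈ C, -x ∈ C) :
    ∃ c : ℝ, 0 < c ∧ ∀ α : ℝ, 2 ≤ α →
      |(({p : ℤ × ℤ | Int.gcd p.1 p.2 = 1 ∧ ((p.1 : ℝ), (p.2 : ℝ)) ∈ α • C}).ncard : ℝ) -
          (6 / π ^ 2) * α ^ 2 * (volume C).toReal| ≤ c * α * Real.log α := by
  by_cases hint : (interior C).Nonempty
  · obtain ⟨s, hs, hball⟩ := exists_ball_subset hconv hsymm hint
    have hV : 0 ≤ (volume C).toReal := ENNReal.toReal_nonneg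
    refine primitive_count_of_lattice_count hbdd
      (hball (Metric.mem_ball_self (inv_pos.2 hs))) (K := (2 * s + s ^ 2) * (volume C).toReal + 1)
      hV (by positivity) fun β hβ => ?_
    have h := abs_le.1 (abs_ncard_latticePoints_smul_sub_le hbdd hconv hs hball hβ)
    have h1 : 0 ≤ s * (volume C).toReal := by positivity
    have h2 : 0 ≤ β * s ^ 2 * (volume C).toReal := by positivity
    rw [abs_le]
    constructor <;> linarith [h.1, h.2]
  · refine ⟨4, by norm_num, fun α hα => ?_⟩
    have hcard : (({p : ℤ × ℤ | Int.gcd p.1 p.2 = 1 ∧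
        ((p.1 : ℝ), (p.2 : ℝ)) ∈ α • C}).ncard : ℝ) ≤ 4 := by
      exact_mod_cast ncard_primitive_smul_le_four_of_interior_eq_empty hconv hsymm hint α
    have hlog : 1 ≤ 2 * Real.log α := by
      have := Real.log_le_log (by norm_num) hα
      have := Real.log_two_gt_d9
      linarith
    rw [volume_eq_zero_of_interior_eq_empty hconv hint, ENNReal.toReal_zero, mul_zero, sub_zero,
      abs_of_nonneg (Nat.cast_nonneg _)]
    nlinarith
end

section
/- Let 𝒞 ⊂ ℝ² be a bounded, convex, centrally symmetric region with Lebesgue measure vol(𝒞). Then there exists a constant c > 0 (depending only on 𝒞) such that for all α ≥ 2, the number M'(α,𝒞) of points (a,b) ∈ α·𝒞 with both a and b odd integers and gcd(a,b) = 1 satisfies |M'(α,𝒞) − (2/π²)·α²·vol(𝒞)| ≤ c·α·log α. -/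
open Real MeasureTheory Pointwise

/-- The integer points of `A` both of whose coordinates are odd. -/
def oddPoints (A : Set (ℝ × ℝ)) : Set (ℤ × ℤ) :=
  {p | Odd p.1 ∧ Odd p.2 ∧ ((p.1 : ℝ), (p.2 : ℝ)) ∈ A}

theorem finite_intPoints_of_subset_closedBall {A : Set (ℝ × ℝ)} {R : ℝ}
    (hA : A ⊆ Metric.closedBall 0 R) : {p : ℤ × ℤ | ((p.1 : ℝ), (p.2 : ℝ)) ∈ A}.Finite := by
  refine (Set.finite_Icc ((-⌈R⌉, -⌈R⌉) : ℤ × ℤ) (⌈R⌉, ⌈R⌉)).subset fun p hp => ?_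
  have h := hA hp
  rw [mem_closedBall_zero_iff, Prod.norm_def, max_le_iff, Real.norm_eq_abs, Real.norm_eq_abs,
    abs_le, abs_le] at h
  obtain ⟨⟨h1, h2⟩, h3, h4⟩ := h
  have hR := Int.le_ceil R
  simp only at h1 h2 h3 h4
  refine ⟨⟨?_, ?_⟩, ⟨?_, ?_⟩⟩ <;> simp only <;> rify <;> linarith

theorem oddPoints_finite {A : Set (ℝ × ℝ)} (hA : Bornology.IsBounded A) :
    (oddPoints A).Finite := by
  obtain ⟨R, hR⟩ := hA.subset_closedBall 0
  exact (finite_intPoints_of_subset_closedBall hR).subset fun p hp => hp.2.2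

/-- The half-open square of side two centred at an integer point. -/
def squareAt (p : ℤ × ℤ) : Set (ℝ × ℝ) :=
  Set.Ico ((p.1 : ℝ) - 1) (p.1 + 1) ×ˢ Set.Ico ((p.2 : ℝ) - 1) (p.2 + 1)

theorem volume_squareAt (p : ℤ × ℤ) : volume (squareAt p) = 4 := by
  rw [squareAt, Measure.volume_eq_prod, Measure.prod_prod, Real.volume_Ico, Real.volume_Ico,
    ← ENNReal.ofReal_mul (by linarith)]
  ring_nf
  simp

theorem measurableSet_squareAt (p : ℤ × ℤ) : MeasurableSet (squareAt p) :=
  measurableSet_Ico.prod measurableSet_Ico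

theorem exists_odd_mem_Ico (x : ℝ) : ∃ k : ℤ, Odd k ∧ x ∈ Set.Ico ((k : ℝ) - 1) (k + 1) := by
  refine ⟨2 * ⌊x / 2⌋ + 1, ⟨_, rfl⟩, ?_, ?_⟩
  · have := Int.floor_le (x / 2); push_cast; linarith
  · have := Int.lt_floor_add_one (x / 2); push_cast; linarith

theorem odd_eq_of_mem_Ico {x : ℝ} {k l : ℤ} (hk : Odd k) (hl : Odd l)
    (hxk : x ∈ Set.Ico ((k : ℝ) - 1) (k + 1)) (hxl : x ∈ Set.Ico ((l : ℝ) - 1) (l + 1)) :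
    k = l := by
  obtain ⟨h1, h2⟩ := hxk
  obtain ⟨h3, h4⟩ := hxl
  have h5 : k < l + 2 := by rify; linarith
  have h6 : l < k + 2 := by rify; linarith
  obtain ⟨a, rfl⟩ := hk
  obtain ⟨b, rfl⟩ := hl
  omega

theorem pairwiseDisjoint_squareAt (A : Set (ℝ × ℝ)) :
    (oddPoints A).PairwiseDisjoint squareAt := by
  intro p hp q hq hpq
  refine Set.disjoint_left.mpr fun x hx hy => hpq ?_
  exact Prod.ext (odd_eq_of_mem_Ico hp.1 hq.1 hx.1 hy.1)
    (odd_eq_of_mem_Ico hp.2.1 hq.2.1 hx.2 hy.2)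

theorem dist_le_one_of_mem_squareAt {p : ℤ × ℤ} {x : ℝ × ℝ} (hx : x ∈ squareAt p) :
    x - ((p.1 : ℝ), (p.2 : ℝ)) ∈ Metric.closedBall (0 : ℝ × ℝ) 1 := by
  obtain ⟨⟨h1, h2⟩, h3, h4⟩ := hx
  rw [mem_closedBall_zero_iff, Prod.norm_def, max_le_iff, Real.norm_eq_abs, Real.norm_eq_abs,
    abs_le, abs_le, Prod.fst_sub, Prod.snd_sub]
  simp only
  refine ⟨⟨?_, ?_⟩, ?_, ?_⟩ <;> linarith

theorem volume_real_smul_plane (C : Set (ℝ × ℝ)) (t : ℝ) :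
    volume.real (t • C) = t ^ 2 * volume.real C := by
  rw [Measure.real, Measure.addHaar_smul, ENNReal.toReal_mul,
    ENNReal.toReal_ofReal (abs_nonneg _)]
  simp [Measure.real]

theorem volume_real_le_ncard_oddPoints {A B : Set (ℝ × ℝ)} (hB : Bornology.IsBounded B)
    (hAB : A + Metric.closedBall 0 1 ⊆ B) :
    volume.real A ≤ 4 * ((oddPoints B).ncard : ℝ) := by
  have hfin := oddPoints_finite hB
  have hsub : A ⊆ ⋃ p ∈ hfin.toFinset, squareAt p := by
    intro x hx
    obtain ⟨k, hk, hxk⟩ := exists_odd_mem_Ico x.1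
    obtain ⟨l, hl, hxl⟩ := exists_odd_mem_Ico x.2
    have hsq : x ∈ squareAt (k, l) := ⟨hxk, hxl⟩
    simp only [Set.mem_iUnion, Set.Finite.mem_toFinset]
    refine ⟨(k, l), ⟨hk, hl, hAB ?_⟩, hsq⟩
    have hd := dist_le_one_of_mem_squareAt hsq
    refine ⟨x, hx, -(x - ((k : ℝ), (l : ℝ))), ?_, by simp⟩
    simpa only [mem_closedBall_zero_iff, norm_neg] using hd
  have h := (measure_mono (μ := volume) hsub).trans (measure_biUnion_finset_le _ _)
  simp only [volume_squareAt, Finset.sum_const, nsmul_eq_mul] at h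
  have h2 := ENNReal.toReal_mono (by finiteness) h
  rw [Set.ncard_eq_toFinset_card _ hfin]
  simp only [ENNReal.toReal_mul, ENNReal.toReal_natCast, ENNReal.toReal_ofNat] at h2
  rw [Measure.real]
  linarith

theorem ncard_oddPoints_le_volume_real {A B : Set (ℝ × ℝ)} (hA : Bornology.IsBounded A)
    (hB : Bornology.IsBounded B) (hAB : A + Metric.closedBall 0 1 ⊆ B) :
    4 * ((oddPoints A).ncard : ℝ) ≤ volume.real B := by
  have hfin := oddPoints_finite hA
  have hsub : (⋃ p ∈ hfin.toFinset, squareAt p) ⊆ B := by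
    simp only [Set.iUnion_subset_iff, Set.Finite.mem_toFinset]
    intro p hp x hx
    exact hAB ⟨_, hp.2.2, _, dist_le_one_of_mem_squareAt hx, by simp⟩
  have h := measure_mono (μ := volume) hsub
  rw [measure_biUnion_finset (by simpa using pairwiseDisjoint_squareAt A)
    (fun p _ => measurableSet_squareAt p)] at h
  simp only [volume_squareAt, Finset.sum_const, nsmul_eq_mul] at h
  have h2 := ENNReal.toReal_mono hB.measure_lt_top.ne h
  rw [Set.ncard_eq_toFinset_card _ hfin]
  simp only [ENNReal.toReal_mul, ENNReal.toReal_natCast, ENNReal.toReal_ofNat] at h2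
  rw [Measure.real]
  linarith

theorem Convex.smul_add_closedBall_subset {C : Set (ℝ × ℝ)} (hconv : Convex ℝ C) {r t : ℝ}
    (hr : 0 < r) (ht : 0 ≤ t) (hball : Metric.closedBall 0 r ⊆ C) :
    t • C + Metric.closedBall 0 1 ⊆ (t + 1 / r) • C := by
  rw [hconv.add_smul ht (by positivity)]
  refine Set.add_subset_add_left fun x hx => ?_
  rw [Set.mem_smul_set_iff_inv_smul_mem₀ (by positivity)]
  apply hball
  rw [mem_closedBall_zero_iff] at hx ⊢
  rw [norm_smul]
  simp only [one_div, inv_inv, Real.norm_eq_abs, abs_of_pos hr]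
  nlinarith

theorem abs_ncard_oddPoints_smul_sub_le {C : Set (ℝ × ℝ)} (hbdd : Bornology.IsBounded C)
    (hconv : Convex ℝ C) {r t : ℝ} (hr : 0 < r) (ht : 0 ≤ t)
    (hball : Metric.closedBall 0 r ⊆ C) :
    |((oddPoints (t • C)).ncard : ℝ) - t ^ 2 / 4 * volume.real C| ≤
      volume.real C * (2 * t / r + 1 / r ^ 2) / 4 := by
  have hV : 0 ≤ volume.real C := measureReal_nonneg
  have hup := ncard_oddPoints_le_volume_real (hbdd.smul₀ t) (hbdd.smul₀ (t + 1 / r))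
    (hconv.smul_add_closedBall_subset hr ht hball)
  rw [volume_real_smul_plane] at hup
  have hexp : (t + 1 / r) ^ 2 = t ^ 2 + (2 * t / r + 1 / r ^ 2) := by ring
  rw [hexp] at hup
  have hlow : (t ^ 2 - (2 * t / r + 1 / r ^ 2)) * volume.real C ≤
      4 * ((oddPoints (t • C)).ncard : ℝ) := by
    rcases le_total (1 / r) t with h | h
    · have h1 := volume_real_le_ncard_oddPoints (hbdd.smul₀ t) (A := (t - 1 / r) • C)
        (by simpa using hconv.smul_add_closedBall_subset hr (sub_nonneg.mpr h) hball)
      rw [volume_real_smul_plane] at h1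
      refine le_trans (mul_le_mul_of_nonneg_right ?_ hV) h1
      have : (t - 1 / r) ^ 2 = t ^ 2 - 2 * t / r + 1 / r ^ 2 := by ring
      have h3 : 0 ≤ 1 / r ^ 2 := by positivity
      linarith
    · refine le_trans (mul_nonpos_of_nonpos_of_nonneg ?_ hV) (by positivity)
      have h2 : t ^ 2 ≤ (1 / r) ^ 2 := by gcongr
      have h3 : (1 / r) ^ 2 = 1 / r ^ 2 := by ring
      have h4 : 0 ≤ 2 * t / r := by positivity
      linarith
  rw [abs_le]
  constructor <;> nlinarith

theorem LSeries_trivChar_two_mul_moebius :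
    LSeries ((fun n : ℕ => (1 : DirichletCharacter ℂ 2) n) *
      fun n : ℕ => (ArithmeticFunction.moebius n : ℂ)) 2 = 8 / (π : ℂ) ^ 2 := by
  have h := DirichletCharacter.LSeries.mul_mu_eq_one (1 : DirichletCharacter ℂ 2)
    (s := 2) (by norm_num)
  have hL := DirichletCharacter.LFunctionTrivChar_eq_mul_riemannZeta (N := 2) (s := 2) (by norm_num)
  rw [DirichletCharacter.LFunctionTrivChar,
    DirichletCharacter.LFunction_eq_LSeries _ (by norm_num), riemannZeta_two,
    Nat.Prime.primeFactors Nat.prime_two, Finset.prod_singleton] at hL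
  have hp : ((2 : ℕ) : ℂ) ^ (-2 : ℂ) = 1 / 4 := by
    rw [Complex.cpow_neg]
    norm_num
  rw [hp] at hL
  rw [hL] at h
  have hpi : (π : ℂ) ≠ 0 := by exact_mod_cast Real.pi_ne_zero
  field_simp
  linear_combination 8 * h

theorem hasSum_odd_moebius_div_sq :
    HasSum (fun n : ℕ => if Odd n then (ArithmeticFunction.moebius n : ℝ) / (n : ℝ) ^ 2 else 0)
      (8 / π ^ 2) := by
  have hs : LSeriesSummable ((fun n : ℕ => (1 : DirichletCharacter ℂ 2) n) *
      fun n : ℕ => (ArithmeticFunction.moebius n : ℂ)) 2 :=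
    DirichletCharacter.LSeriesSummable_mul _
      (ArithmeticFunction.LSeriesSummable_moebius_iff.mpr (by norm_num))
  have h := Summable.hasSum hs
  have ht := LSeries_trivChar_two_mul_moebius
  rw [LSeries] at ht
  rw [ht] at h
  rw [← Complex.hasSum_ofReal]
  convert! h using 1
  · funext n
    rw [LSeries.term_def]
    split_ifs with h1 h2 h2
    · simp [h2] at h1
    · have : ((n : ℕ) : ZMod 2) = 1 := by
        rw [ZMod.natCast_eq_one_iff_odd]; exact h1
      simp [this]
    · simp
    · have : ((n : ℕ) : ZMod 2) = 0 := by
        rw [ZMod.natCast_eq_zero_iff_even]; exact Nat.not_odd_iff_even.mp h1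
      simp [this, MulChar.map_zero (1 : DirichletCharacter ℂ 2)]
  · push_cast; rfl

theorem abs_sum_odd_moebius_div_sq_sub_le (K : ℕ) :
    |∑ d ∈ (Finset.Icc 1 K).filter Odd, (ArithmeticFunction.moebius d : ℝ) / (d : ℝ) ^ 2 -
      8 / π ^ 2| ≤ 2 / ((K : ℝ) + 1) := by
  set f : ℕ → ℝ := fun n =>
    if Odd n then (ArithmeticFunction.moebius n : ℝ) / (n : ℝ) ^ 2 else 0 with hf
  have habs : ∀ n, |f n| ≤ ((n : ℝ) ^ 2)⁻¹ := by
    intro n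
    simp only [hf]
    split_ifs
    · rw [abs_div, abs_of_nonneg (sq_nonneg (n : ℝ)), div_eq_mul_inv]
      apply mul_le_of_le_one_left (by positivity)
      exact_mod_cast ArithmeticFunction.abs_moebius_le_one (n := n)
    · simp
  have hS : ∑ d ∈ (Finset.Icc 1 K).filter Odd,
      (ArithmeticFunction.moebius d : ℝ) / (d : ℝ) ^ 2 = ∑ d ∈ Finset.range (K + 1), f d := by
    rw [Finset.sum_filter, Finset.range_eq_Ico, Finset.sum_eq_sum_Ico_succ_bot (by omega)]
    simp only [hf]
    simp
    rfl
  rw [hS, abs_sub_comm]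
  have hlim := hasSum_odd_moebius_div_sq.tendsto_sum_nat
  have hlim2 := (hlim.sub_const (∑ d ∈ Finset.range (K + 1), f d)).abs
  refine le_of_tendsto hlim2 ?_
  filter_upwards [Filter.eventually_ge_atTop (K + 1)] with n hn
  rw [← Finset.sum_Ico_eq_sub _ hn]
  refine (Finset.abs_sum_le_sum_abs _ _).trans ((Finset.sum_le_sum fun i _ => habs i).trans ?_)
  have := sum_Ioo_inv_sq_le (α := ℝ) K n
  exact this

theorem exists_closedBall_subset_of_interior_nonempty {C : Set (ℝ × ℝ)} (hconv : Convex ℝ C)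
    (hsymm : ∀ x ∈ C, -x ∈ C) (h : (interior C).Nonempty) :
    ∃ r : ℝ, 0 < r ∧ Metric.closedBall 0 r ⊆ C := by
  obtain ⟨x, hx⟩ := h
  have h0 : (0 : ℝ × ℝ) ∈ interior C := by
    apply hconv.openSegment_interior_self_subset_interior hx (hsymm x (interior_subset hx))
    exact ⟨1 / 2, 1 / 2, by norm_num, by norm_num, by norm_num, by simp⟩
  exact Metric.nhds_basis_closedBall.mem_iff.mp (mem_interior_iff_mem_nhds.mp h0)

theorem cross_eq_of_interior_empty {C : Set (ℝ × ℝ)} (hconv : Convex ℝ C)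
    (hsymm : ∀ x ∈ C, -x ∈ C) (h : ¬(interior C).Nonempty) {p q : ℝ × ℝ} (hp : p ∈ C)
    (hq : q ∈ C) : p.1 * q.2 = p.2 * q.1 := by
  by_contra hne
  apply h
  have h0 : (0 : ℝ × ℝ) ∈ C := by
    have := hconv hp (hsymm p hp) (a := 1 / 2) (b := 1 / 2) (by norm_num) (by norm_num)
      (by norm_num)
    simpa using this
  rw [hconv.interior_nonempty_iff_affineSpan_eq_top,
    AffineSubspace.affineSpan_eq_top_iff_vectorSpan_eq_top_of_nonempty _ _ _ ⟨0, h0⟩, eq_top_iff]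
  rintro ⟨x, y⟩ -
  have hD : p.1 * q.2 - p.2 * q.1 ≠ 0 := sub_ne_zero.mpr hne
  have hp' : p ∈ vectorSpan ℝ C := by simpa using vsub_mem_vectorSpan ℝ hp h0
  have hq' : q ∈ vectorSpan ℝ C := by simpa using vsub_mem_vectorSpan ℝ hq h0
  have := (vectorSpan ℝ C).add_mem
    ((vectorSpan ℝ C).smul_mem ((x * q.2 - y * q.1) / (p.1 * q.2 - p.2 * q.1)) hp')
    ((vectorSpan ℝ C).smul_mem ((p.1 * y - p.2 * x) / (p.1 * q.2 - p.2 * q.1)) hq')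
  convert! this using 1
  ext
  · simp only [Prod.fst_add, Prod.smul_fst, smul_eq_mul]
    rw [div_mul_eq_mul_div, div_mul_eq_mul_div, ← add_div, eq_div_iff hD]
    ring
  · simp only [Prod.snd_add, Prod.smul_snd, smul_eq_mul]
    rw [div_mul_eq_mul_div, div_mul_eq_mul_div, ← add_div, eq_div_iff hD]
    ring

theorem Convex.volume_eq_zero_of_interior_empty {C : Set (ℝ × ℝ)} (hconv : Convex ℝ C)
    (h : ¬(interior C).Nonempty) : volume C = 0 := by
  refine measure_mono_null ?_ (hconv.addHaar_frontier volume)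
  rw [frontier, Set.not_nonempty_iff_eq_empty.mp h, Set.sdiff_empty]
  exact subset_closure

/-- The primitive integer points of `A` both of whose coordinates are odd. -/
def primitiveOddPoints (A : Set (ℝ × ℝ)) : Set (ℤ × ℤ) :=
  {p | Odd p.1 ∧ Odd p.2 ∧ Int.gcd p.1 p.2 = 1 ∧ ((p.1 : ℝ), (p.2 : ℝ)) ∈ A}

theorem eq_or_eq_neg_of_cross_eq {p q : ℤ × ℤ} (hp : Int.gcd p.1 p.2 = 1)
    (hq : Int.gcd q.1 q.2 = 1) (hp0 : p.1 ≠ 0) (h : p.1 * q.2 = p.2 * q.1) :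
    q = p ∨ q = -p := by
  have h1 : p.1 ∣ q.1 :=
    Int.dvd_of_dvd_mul_right_of_gcd_one (Dvd.intro _ h) hp
  have h2 : q.1 ∣ p.1 :=
    Int.dvd_of_dvd_mul_left_of_gcd_one (Dvd.intro_left _ h.symm) hq
  rcases Int.natAbs_eq_natAbs_iff.mp (Int.natAbs_eq_of_dvd_dvd h2 h1) with h3 | h3
  · left
    refine Prod.ext h3 (mul_left_cancel₀ hp0 ?_)
    rw [h, h3, mul_comm]
  · right
    refine Prod.ext h3 (mul_left_cancel₀ hp0 ?_)
    rw [h, h3, Prod.snd_neg]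
    ring

theorem ncard_primitiveOddPoints_le_two {A : Set (ℝ × ℝ)}
    (hA : ∀ p ∈ A, ∀ q ∈ A, p.1 * q.2 = p.2 * q.1) : (primitiveOddPoints A).ncard ≤ 2 := by
  rcases (primitiveOddPoints A).eq_empty_or_nonempty with h | ⟨p, hp⟩
  · simp [h]
  · have hsub : primitiveOddPoints A ⊆ {p, -p} := by
      intro q hq
      have h : (p.1 : ℝ) * q.2 = p.2 * q.1 := hA _ hp.2.2.2 _ hq.2.2.2
      have hp0 : p.1 ≠ 0 := by
        intro h0
        simpa [h0] using hp.1
      exact eq_or_eq_neg_of_cross_eq hp.2.2.1 hq.2.2.1 hp0 (by exact_mod_cast h)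
    calc (primitiveOddPoints A).ncard ≤ ({p, -p} : Set (ℤ × ℤ)).ncard := Set.ncard_le_ncard hsub
      _ ≤ ({-p} : Set (ℤ × ℤ)).ncard + 1 := Set.ncard_insert_le _ _
      _ = 2 := by rw [Set.ncard_singleton]

theorem sum_divisors_moebius (n : ℕ) :
    ∑ d ∈ n.divisors, ArithmeticFunction.moebius d = if n = 1 then 1 else 0 := by
  rw [← ArithmeticFunction.coe_mul_zeta_apply, ArithmeticFunction.moebius_mul_coe_zeta,
    ArithmeticFunction.one_apply]

theorem mem_div_smul_iff {C : Set (ℝ × ℝ)} {α : ℝ} {d : ℕ} (hd : d ≠ 0) (x y : ℝ) :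
    (x, y) ∈ (α / d) • C ↔ ((d : ℝ) * x, (d : ℝ) * y) ∈ α • C := by
  have hd' : (d : ℝ) ≠ 0 := by exact_mod_cast hd
  have h : α • C = (d : ℝ) • (α / d) • C := by
    rw [smul_smul, mul_div_cancel₀ _ hd']
  rw [h, ← Set.smul_mem_smul_set_iff₀ hd' ((α / d) • C)]
  rfl

theorem ncard_oddPoints_dvd_gcd (C : Set (ℝ × ℝ)) (α : ℝ) {d : ℕ} (hd : Odd d) :
    {p ∈ oddPoints (α • C) | d ∣ Int.gcd p.1 p.2}.ncard =
      (oddPoints ((α / d) • C)).ncard := by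
  have hd0 : d ≠ 0 := hd.pos.ne'
  have hdz : (d : ℤ) ≠ 0 := by exact_mod_cast hd0
  have hdodd : Odd (d : ℤ) := by exact_mod_cast hd
  have himg : {p ∈ oddPoints (α • C) | d ∣ Int.gcd p.1 p.2} =
      (fun p : ℤ × ℤ => ((d : ℤ) * p.1, (d : ℤ) * p.2)) '' oddPoints ((α / d) • C) := by
    ext ⟨a, b⟩
    constructor
    · rintro ⟨⟨ha, hb, hab⟩, hdvd⟩
      obtain ⟨x, hx⟩ := (Int.natCast_dvd_natCast.mpr hdvd).trans (Int.gcd_dvd_left a b)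
      obtain ⟨y, hy⟩ := (Int.natCast_dvd_natCast.mpr hdvd).trans (Int.gcd_dvd_right a b)
      subst hx hy
      refine ⟨(x, y), ⟨(Int.odd_mul.mp ha).2, (Int.odd_mul.mp hb).2, ?_⟩, rfl⟩
      rw [mem_div_smul_iff hd0]
      exact_mod_cast hab
    · rintro ⟨⟨x, y⟩, ⟨hx, hy, hxy⟩, heq⟩
      obtain ⟨rfl, rfl⟩ := Prod.mk.inj heq
      rw [mem_div_smul_iff hd0] at hxy
      refine ⟨⟨hdodd.mul hx, hdodd.mul hy, by push_cast; exact hxy⟩, ?_⟩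
      exact Int.dvd_gcd (Dvd.intro _ rfl) (Dvd.intro _ rfl)
  rw [himg]
  refine Set.ncard_image_of_injective _ fun p q hpq => ?_
  obtain ⟨h1, h2⟩ := Prod.mk.inj hpq
  exact Prod.ext (mul_left_cancel₀ hdz h1) (mul_left_cancel₀ hdz h2)

theorem gcd_le_floor_of_mem_oddPoints {A : Set (ℝ × ℝ)} {R : ℝ}
    (hA : A ⊆ Metric.closedBall 0 R) {p : ℤ × ℤ} (hp : p ∈ oddPoints A) :
    Int.gcd p.1 p.2 ≤ ⌊R⌋₊ := by
  have h0 : p.1 ≠ 0 := by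
    intro h0
    simpa [h0] using hp.1
  have h := hA hp.2.2
  rw [mem_closedBall_zero_iff, Prod.norm_def, max_le_iff, Real.norm_eq_abs] at h
  apply Nat.le_floor
  refine le_trans ?_ h.1
  have h1 := Nat.le_of_dvd (Int.natAbs_pos.mpr h0)
    (Int.natCast_dvd.mp (Int.gcd_dvd_left p.1 p.2))
  calc ((Int.gcd p.1 p.2 : ℕ) : ℝ) ≤ (p.1.natAbs : ℝ) := by exact_mod_cast h1
    _ = |(p.1 : ℝ)| := by rw [Nat.cast_natAbs, Int.cast_abs]

/-- Möbius inversion for odd lattice points: only odd divisors contribute. -/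
theorem ncard_primitiveOddPoints_smul_eq {C : Set (ℝ × ℝ)} {α R : ℝ}
    (hC : α • C ⊆ Metric.closedBall 0 R) :
    ((primitiveOddPoints (α • C)).ncard : ℝ) =
      ∑ d ∈ (Finset.Icc 1 ⌊R⌋₊).filter Odd,
        (ArithmeticFunction.moebius d : ℝ) * ((oddPoints ((α / d) • C)).ncard : ℝ) := by
  have hfin : (oddPoints (α • C)).Finite := oddPoints_finite (Metric.isBounded_closedBall.subset hC)
  have hprim : primitiveOddPoints (α • C) =
      ↑(hfin.toFinset.filter fun p => Int.gcd p.1 p.2 = 1) := by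
    ext p
    simp only [Finset.coe_filter, Set.Finite.mem_toFinset, Set.mem_ofPred_eq, primitiveOddPoints,
      oddPoints]
    tauto
  have hcard : ∀ d ∈ (Finset.Icc 1 ⌊R⌋₊).filter Odd, (oddPoints ((α / d) • C)).ncard =
      (hfin.toFinset.filter fun p => d ∣ Int.gcd p.1 p.2).card := by
    intro d hd
    rw [← ncard_oddPoints_dvd_gcd C α (Finset.mem_filter.mp hd).2, ← Set.ncard_coe_finset]
    congr 1
    ext p
    simp
  have hdiv : ∀ p ∈ hfin.toFinset, (Int.gcd p.1 p.2).divisors =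
      ((Finset.Icc 1 ⌊R⌋₊).filter Odd).filter (· ∣ Int.gcd p.1 p.2) := by
    intro p hp
    rw [Set.Finite.mem_toFinset] at hp
    have hg := gcd_le_floor_of_mem_oddPoints hC hp
    have h0 : p.1 ≠ 0 := by
      intro h0
      simpa [h0] using hp.1
    have hg0 : 0 < Int.gcd p.1 p.2 := Int.gcd_pos_of_ne_zero_left _ h0
    ext d
    simp only [Nat.mem_divisors, Finset.mem_filter, Finset.mem_Icc]
    constructor
    · rintro ⟨hd, -⟩
      refine ⟨⟨⟨Nat.pos_of_dvd_of_pos hd hg0, (Nat.le_of_dvd hg0 hd).trans hg⟩, ?_⟩, hd⟩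
      have h1 : (d : ℤ) ∣ p.1 := (Int.natCast_dvd_natCast.mpr hd).trans (Int.gcd_dvd_left _ _)
      obtain ⟨k, hk⟩ := h1
      have h2 : Odd ((d : ℤ) * k) := hk ▸ hp.1
      exact_mod_cast (Int.odd_mul.mp h2).1
    · rintro ⟨-, hd⟩
      exact ⟨hd, hg0.ne'⟩
  rw [hprim, Set.ncard_coe_finset]
  have key : (((hfin.toFinset.filter fun p => Int.gcd p.1 p.2 = 1).card : ℕ) : ℤ) =
      ∑ d ∈ (Finset.Icc 1 ⌊R⌋₊).filter Odd,
        ArithmeticFunction.moebius d * ((oddPoints ((α / d) • C)).ncard : ℤ) := by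
    rw [Finset.card_filter, Nat.cast_sum]
    calc ∑ p ∈ hfin.toFinset, ((if Int.gcd p.1 p.2 = 1 then 1 else 0 : ℕ) : ℤ)
        = ∑ p ∈ hfin.toFinset, ∑ d ∈ (Finset.Icc 1 ⌊R⌋₊).filter Odd,
            if d ∣ Int.gcd p.1 p.2 then ArithmeticFunction.moebius d else 0 := by
          refine Finset.sum_congr rfl fun p hp => ?_
          rw [← Finset.sum_filter, ← hdiv p hp, sum_divisors_moebius]
          push_cast
          rfl
      _ = _ := by
          rw [Finset.sum_comm]
          refine Finset.sum_congr rfl fun d hd => ?_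
          rw [hcard d hd, ← Finset.sum_filter, Finset.sum_const, nsmul_eq_mul, mul_comm]
  exact_mod_cast congrArg (Int.cast : ℤ → ℝ) key

theorem sum_Icc_inv_le_one_add_log {x : ℝ} (hx : 1 ≤ x) :
    ∑ d ∈ Finset.Icc 1 ⌊x⌋₊, ((d : ℝ))⁻¹ ≤ 1 + Real.log x := by
  have h := harmonic_floor_le_one_add_log x hx
  rw [harmonic_eq_sum_Icc] at h
  push_cast at h
  exact h

theorem abs_ncard_primitiveOddPoints_smul_sub_le {C : Set (ℝ × ℝ)} (hconv : Convex ℝ C)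
    {r R α : ℝ} (hr : 0 < r) (hball : Metric.closedBall 0 r ⊆ C) (hR : 1 ≤ R)
    (hCR : C ⊆ Metric.closedBall 0 R) (hα : 1 ≤ α) :
    |((primitiveOddPoints (α • C)).ncard : ℝ) - (2 / π ^ 2) * α ^ 2 * volume.real C| ≤
      volume.real C / 4 * (2 * α / r * (1 + Real.log (α * R)) + α * R / r ^ 2) +
        α * volume.real C := by
  have hα0 : 0 < α := by linarith
  have hbdd : Bornology.IsBounded C := Metric.isBounded_closedBall.subset hCR
  have hαR : α • C ⊆ Metric.closedBall 0 (α * R) := by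
    rintro _ ⟨x, hx, rfl⟩
    have h := hCR hx
    rw [mem_closedBall_zero_iff] at h ⊢
    simp only [norm_smul, Real.norm_eq_abs, abs_of_pos hα0]
    gcongr
  have h1 : 1 ≤ α * R := by nlinarith
  set V := volume.real C with hVdef
  have hV : 0 ≤ V := measureReal_nonneg
  set K := ⌊α * R⌋₊ with hK
  have hKle : (K : ℝ) ≤ α * R := Nat.floor_le (by linarith)
  have hKlt : α * R < (K : ℝ) + 1 := Nat.lt_floor_add_one _
  rw [ncard_primitiveOddPoints_smul_eq hαR]
  have hsplit : ∑ d ∈ (Finset.Icc 1 K).filter Odd,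
        (ArithmeticFunction.moebius d : ℝ) * ((oddPoints ((α / d) • C)).ncard : ℝ) -
      (2 / π ^ 2) * α ^ 2 * V =
      ∑ d ∈ (Finset.Icc 1 K).filter Odd, (ArithmeticFunction.moebius d : ℝ) *
        (((oddPoints ((α / d) • C)).ncard : ℝ) - (α / d) ^ 2 / 4 * V) +
      α ^ 2 * V / 4 * (∑ d ∈ (Finset.Icc 1 K).filter Odd,
        (ArithmeticFunction.moebius d : ℝ) / (d : ℝ) ^ 2 - 8 / π ^ 2) := by
    have : ∑ d ∈ (Finset.Icc 1 K).filter Odd, (ArithmeticFunction.moebius d : ℝ) *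
        ((α / d) ^ 2 / 4 * V) = α ^ 2 * V / 4 * ∑ d ∈ (Finset.Icc 1 K).filter Odd,
        (ArithmeticFunction.moebius d : ℝ) / (d : ℝ) ^ 2 := by
      rw [Finset.mul_sum]
      exact Finset.sum_congr rfl fun d _ => by ring
    simp only [mul_sub, Finset.sum_sub_distrib, this]
    ring
  rw [hsplit]
  refine (abs_add_le _ _).trans (add_le_add ?_ ?_)
  · calc _ ≤ ∑ d ∈ (Finset.Icc 1 K).filter Odd,
          V * (2 * (α / d) / r + 1 / r ^ 2) / 4 := by
          refine (Finset.abs_sum_le_sum_abs _ _).trans (Finset.sum_le_sum fun d _ => ?_)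
          rw [abs_mul]
          have hμ : |(ArithmeticFunction.moebius d : ℝ)| ≤ 1 := by
            exact_mod_cast ArithmeticFunction.abs_moebius_le_one (n := d)
          exact (mul_le_of_le_one_left (abs_nonneg _) hμ).trans
            (abs_ncard_oddPoints_smul_sub_le hbdd hconv hr (by positivity) hball)
      _ ≤ ∑ d ∈ Finset.Icc 1 K, V * (2 * (α / d) / r + 1 / r ^ 2) / 4 :=
          Finset.sum_le_sum_of_subset_of_nonneg (Finset.filter_subset _ _)
            fun d _ _ => by positivity
      _ = V / 4 * (2 * α / r * ∑ d ∈ Finset.Icc 1 K, ((d : ℝ))⁻¹ + K / r ^ 2) := by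
          have hc : (K : ℝ) / r ^ 2 = ∑ d ∈ Finset.Icc 1 K, 1 / r ^ 2 := by
            simp [div_eq_mul_inv]
          rw [hc, Finset.mul_sum, ← Finset.sum_add_distrib, Finset.mul_sum]
          exact Finset.sum_congr rfl fun d _ => by ring
      _ ≤ _ := by
          have := sum_Icc_inv_le_one_add_log h1
          gcongr
  · rw [abs_mul, abs_of_nonneg (by positivity : 0 ≤ α ^ 2 * V / 4)]
    have htail := (abs_sum_odd_moebius_div_sq_sub_le K).trans
      (div_le_div_of_nonneg_left (by norm_num) hα0 (by nlinarith : α ≤ (K : ℝ) + 1))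
    refine (mul_le_mul_of_nonneg_left htail (by positivity)).trans ?_
    have h2 : α ^ 2 * V / 4 * (2 / α) = α * V / 2 := by
      field_simp
      ring
    rw [h2]
    have : 0 ≤ α * V := by positivity
    linarith

/-- count of primitive lattice points with both coordinates odd
in a dilated bounded convex centrally-symmetric region of the plane. -/
theorem primitive_odd_lattice_count_convex (C : Set (ℝ × ℝ)) (hbdd : Bornology.IsBounded C)
    (hconv : Convex ℝ C) (hsymm : ∀ x ∈ C, -x ∈ C) :
    ∃ c : ℝ, 0 < c ∧ ∀ α : ℝ, 2 ≤ α →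
      |(({p : ℤ × ℤ | Odd p.1 ∧ Odd p.2 ∧ Int.gcd p.1 p.2 = 1 ∧
            ((p.1 : ℝ), (p.2 : ℝ)) ∈ α • C}).ncard : ℝ) -
          (2 / π ^ 2) * α ^ 2 * (volume C).toReal| ≤ c * α * Real.log α := by
  have hlog : ∀ α : ℝ, 2 ≤ α → 1 ≤ 2 * Real.log α := fun α hα => by
    have h1 := Real.log_two_gt_d9
    have h2 := Real.log_le_log (by norm_num) hα
    linarith
  by_cases hint : (interior C).Nonempty
  · obtain ⟨r, hr, hball⟩ := exists_closedBall_subset_of_interior_nonempty hconv hsymm hint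
    obtain ⟨R, hR1, hR⟩ : ∃ R : ℝ, 1 ≤ R ∧ C ⊆ Metric.closedBall 0 R := by
      obtain ⟨R, hR⟩ := hbdd.subset_closedBall 0
      exact ⟨max 1 R, le_max_left _ _,
        hR.trans (Metric.closedBall_subset_closedBall (le_max_right _ _))⟩
    have hV : 0 ≤ volume.real C := measureReal_nonneg
    have hlogR : 0 ≤ Real.log R := Real.log_nonneg hR1
    refine ⟨volume.real C / 4 * (2 / r * (3 + 2 * Real.log R) + 2 * R / r ^ 2) +
      2 * volume.real C + 1, by positivity, fun α hα => ?_⟩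
    have hL := hlog α hα
    have hα0 : 0 < α := by linarith
    have hL0 : 0 ≤ Real.log α := by linarith
    refine (abs_ncard_primitiveOddPoints_smul_sub_le hconv hr hball hR1 hR
      (by linarith)).trans ?_
    rw [Real.log_mul hα0.ne' (by linarith)]
    have e1 : 1 + (Real.log α + Real.log R) ≤ (3 + 2 * Real.log R) * Real.log α := by nlinarith
    have e2 : α * R / r ^ 2 ≤ α * R / r ^ 2 * (2 * Real.log α) :=
      le_mul_of_one_le_right (by positivity) hL
    have e3 : α * volume.real C ≤ α * volume.real C * (2 * Real.log α) :=
      le_mul_of_one_le_right (by positivity) hL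
    calc _ ≤ volume.real C / 4 * (2 * α / r * ((3 + 2 * Real.log R) * Real.log α) +
          α * R / r ^ 2 * (2 * Real.log α)) + α * volume.real C * (2 * Real.log α) := by
          gcongr
      _ = (volume.real C / 4 * (2 / r * (3 + 2 * Real.log R) + 2 * R / r ^ 2) +
          2 * volume.real C) * α * Real.log α := by ring
      _ ≤ _ := by
          refine mul_le_mul_of_nonneg_right (mul_le_mul_of_nonneg_right ?_ hα0.le) hL0
          linarith
  · refine ⟨2, by norm_num, fun α hα => ?_⟩
    have hcross : ∀ p ∈ α • C, ∀ q ∈ α • C, p.1 * q.2 = p.2 * q.1 := by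
      rintro _ ⟨p, hp, rfl⟩ _ ⟨q, hq, rfl⟩
      have := cross_eq_of_interior_empty hconv hsymm hint hp hq
      simp only [Prod.smul_fst, Prod.smul_snd, smul_eq_mul]
      linear_combination α ^ 2 * this
    have h2 : ((primitiveOddPoints (α • C)).ncard : ℝ) ≤ 2 := by
      exact_mod_cast ncard_primitiveOddPoints_le_two hcross
    rw [hconv.volume_eq_zero_of_interior_empty hint, ENNReal.toReal_zero, mul_zero, sub_zero,
      abs_of_nonneg (Nat.cast_nonneg _)]
    refine le_trans h2 ?_
    nlinarith [hlog α hα]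
end

section
/- Let n ≥ 2 and let a_1, …, a_n be positive integers with gcd(a_1, …, a_n) = 1. For a positive integer N, let p(N) denote the number of tuples (x_1, …, x_n) of non-negative integers with a_1·x_1 + a_2·x_2 + ⋯ + a_n·x_n = N. Then there exists a constant c > 0 such that for all N ≥ 1, |p(N) − N^{n−1}/((a_1·a_2⋯a_n)·(n−1)!)| ≤ c·N^{n−2}. -/
/-- The number of `x : Fin n → ℕ` with `∑ i, a i * x i = N`. -/
noncomputable def partitionCount {n : ℕ} (a : Fin n → ℕ) (N : ℕ) : ℕ :=
  Nat.card {x : Fin n → ℕ // ∑ i, a i * x i = N}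

theorem finite_partitions {n : ℕ} (a : Fin n → ℕ) (ha : ∀ i, 0 < a i) (N : ℕ) :
    Finite {x : Fin n → ℕ // ∑ i, a i * x i = N} := by
  have h : {x : Fin n → ℕ | ∑ i, a i * x i = N} ⊆ Set.Iic (fun _ => N) := by
    intro x hx i
    have h1 : a i * x i ≤ ∑ i, a i * x i :=
      Finset.single_le_sum (f := fun i => a i * x i) (fun _ _ => Nat.zero_le _) (Finset.mem_univ i)
    have h2 : ∑ i, a i * x i = N := hx
    have h3 := Nat.le_mul_of_pos_left (x i) (ha i)
    show x i ≤ N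
    omega
  exact ((Set.finite_Iic _).subset h).to_subtype

theorem partitionCount_eq_zero {n : ℕ} (a : Fin n → ℕ) {N : ℕ}
    (h : ¬ Finset.univ.gcd a ∣ N) : partitionCount a N = 0 := by
  have : IsEmpty {x : Fin n → ℕ // ∑ i, a i * x i = N} := by
    refine ⟨fun x => h ?_⟩
    rw [← x.2]
    exact Finset.dvd_sum fun i hi => (Finset.gcd_dvd hi).mul_right _
  exact Nat.card_of_isEmpty

theorem partitionCount_one (a : Fin 1 → ℕ) (ha : 0 < a 0) {N : ℕ} (h : a 0 ∣ N) :
    partitionCount a N = 1 := by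
  obtain ⟨k, rfl⟩ := h
  refine Nat.card_eq_one_iff_exists.mpr ⟨⟨fun _ => k, by simp⟩, ?_⟩
  rintro ⟨x, hx⟩
  ext i
  rw [Fin.sum_univ_one] at hx
  rw [Subsingleton.elim i 0]
  exact Nat.eq_of_mul_eq_mul_left ha hx

theorem partitionCount_succ {n : ℕ} (a : Fin (n + 1) → ℕ) (ha : ∀ i, 0 < a i) {N : ℕ}
    (h : a 0 ≤ N) :
    partitionCount a N = partitionCount a (N - a 0) + partitionCount (Fin.tail a) N := by
  have := finite_partitions a ha (N - a 0)
  have := finite_partitions (Fin.tail a) (fun i => ha i.succ) N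
  unfold partitionCount
  rw [← Nat.card_sum]
  symm
  refine Nat.card_congr (Equiv.ofBijective (Sum.elim
    (fun x => ⟨Fin.cons (x.1 0 + 1) (Fin.tail x.1), ?_⟩) (fun y => ⟨Fin.cons 0 y.1, ?_⟩)) ⟨?_, ?_⟩)
  · have := x.2
    rw [Fin.sum_univ_succ] at this ⊢
    simp only [Fin.cons_zero, Fin.cons_succ, Fin.tail, mul_add]
    omega
  · have := y.2
    rw [Fin.sum_univ_succ]
    simpa [Fin.tail] using this
  · rintro (⟨x, hx⟩ | ⟨x, hx⟩) (⟨y, hy⟩ | ⟨y, hy⟩) hxy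
    · simp only [Sum.elim_inl, Subtype.mk.injEq, Fin.cons_inj] at hxy
      congr 2
      rw [← Fin.cons_self_tail x, ← Fin.cons_self_tail y, hxy.2, Nat.succ_injective hxy.1]
    · simp [Fin.cons_inj] at hxy
    · simp [Fin.cons_inj] at hxy
    · simpa [Fin.cons_inj] using hxy
  · rintro ⟨x, hx⟩
    rcases hx0 : x 0 with _ | k
    · refine ⟨Sum.inr ⟨Fin.tail x, ?_⟩, ?_⟩
      · rw [Fin.sum_univ_succ, hx0] at hx
        simpa [Fin.tail] using hx
      · simp only [Sum.elim_inr, Subtype.mk.injEq]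
        rw [← hx0, Fin.cons_self_tail]
    · refine ⟨Sum.inl ⟨Fin.cons k (Fin.tail x), ?_⟩, ?_⟩
      · rw [Fin.sum_univ_succ, hx0] at hx
        rw [Fin.sum_univ_succ]
        simp only [Fin.cons_zero, Fin.cons_succ, Fin.tail, mul_add] at hx ⊢
        omega
      · simp only [Sum.elim_inl, Subtype.mk.injEq, Fin.cons_zero, Fin.tail_cons]
        rw [← hx0, Fin.cons_self_tail]

theorem partitionCount_sub_mul {n : ℕ} (a : Fin (n + 1) → ℕ) (ha : ∀ i, 0 < a i) {N : ℕ} (e : ℕ)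
    (h : a 0 * e ≤ N) :
    partitionCount a N = partitionCount a (N - a 0 * e) +
      ∑ k ∈ Finset.range e, partitionCount (Fin.tail a) (N - a 0 * k) := by
  induction e with
  | zero => simp
  | succ e ih =>
    rw [mul_add, mul_one] at h
    rw [ih (by omega), Finset.sum_range_succ,
      partitionCount_succ a ha (N := N - a 0 * e) (by omega), mul_add, mul_one, Nat.sub_sub]
    ring

theorem gcd_univ_succ {n : ℕ} (a : Fin (n + 1) → ℕ) :
    Finset.univ.gcd a = Nat.gcd (a 0) (Finset.univ.gcd (Fin.tail a)) := by
  refine Nat.dvd_antisymm ?_ ?_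
  · exact Nat.dvd_gcd (Finset.gcd_dvd (Finset.mem_univ _))
      (Finset.dvd_gcd fun i _ => Finset.gcd_dvd (f := a) (Finset.mem_univ i.succ))
  · refine Finset.dvd_gcd fun i _ => ?_
    refine Fin.cases (Nat.gcd_dvd_left _ _) (fun j => ?_) i
    exact (Nat.gcd_dvd_right _ _).trans (Finset.gcd_dvd (f := Fin.tail a) (Finset.mem_univ j))

/-- If `gcd b d ∣ N`, exactly one of the first `d / gcd b d` terms of the progression
`N, N - b, N - 2 * b, …` is divisible by `d`. -/
theorem existsUnique_dvd_sub_mul {b d N : ℕ} (hd : 0 < d) (hN : Nat.gcd b d ∣ N)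
    (hle : b * (d / Nat.gcd b d) ≤ N) :
    ∃ k < d / Nat.gcd b d, d ∣ N - b * k ∧
      ∀ j < d / Nat.gcd b d, d ∣ N - b * j → j = k := by
  have hg : 0 < Nat.gcd b d := Nat.gcd_pos_of_pos_right _ hd
  have hcop := Nat.coprime_div_gcd_div_gcd hg
  set g := Nat.gcd b d with hgdef
  obtain ⟨b', hb'⟩ : g ∣ b := Nat.gcd_dvd_left _ _
  obtain ⟨e, he⟩ : g ∣ d := Nat.gcd_dvd_right _ _
  obtain ⟨M, rfl⟩ := hN
  clear_value g
  have hbg : b / g = b' := by rw [hb', Nat.mul_div_cancel_left _ hg]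
  have hdg : d / g = e := by rw [he, Nat.mul_div_cancel_left _ hg]
  rw [hbg, hdg] at hcop
  rw [hdg] at hle ⊢
  subst hb' he
  clear hgdef hbg hdg
  have hepos : 0 < e := Nat.pos_of_mul_pos_left hd
  have hle' : b' * e ≤ M := by
    rw [mul_assoc] at hle
    exact Nat.le_of_mul_le_mul_left hle hg
  have key : ∀ k < e, (g * e ∣ g * M - g * b' * k ↔ b' * k ≡ M [MOD e]) := by
    intro k hk
    have : b' * k ≤ M := (Nat.mul_le_mul_left _ hk.le).trans hle'
    rw [mul_assoc, ← Nat.mul_sub, Nat.mul_dvd_mul_iff_left hg, Nat.modEq_iff_dvd' this]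
  obtain ⟨k, hk⟩ : ∃ k, b' * k ≡ M [MOD e] := by
    have : NeZero e := ⟨hepos.ne'⟩
    refine ⟨((b' : ZMod e)⁻¹ * M).val, ?_⟩
    rw [← ZMod.natCast_eq_natCast_iff]
    push_cast
    rw [ZMod.natCast_zmod_val, ← mul_assoc, ZMod.coe_mul_inv_eq_one _ hcop, one_mul]
  have hk' : b' * (k % e) ≡ M [MOD e] := ((Nat.mod_modEq k e).mul_left b').trans hk
  refine ⟨k % e, Nat.mod_lt _ hepos, (key _ (Nat.mod_lt _ hepos)).2 hk', fun j hj hdvd => ?_⟩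
  have := (((key j hj).1 hdvd).trans hk'.symm).cancel_left_of_coprime (by simpa using hcop.symm)
  exact this.eq_of_lt_of_lt hj (Nat.mod_lt _ hepos)

theorem pow_sub_pow_le_mul {x y : ℝ} (hy : 0 ≤ y) (hxy : y ≤ x) (m : ℕ) :
    x ^ m - y ^ m ≤ m * x ^ (m - 1) * (x - y) := by
  have hx := hy.trans hxy
  induction m with
  | zero => simp
  | succ m ih =>
    have h1 : x * (x ^ m - y ^ m) ≤ m * x ^ m * (x - y) := by
      refine (mul_le_mul_of_nonneg_left ih hx).trans_eq ?_
      cases m with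
      | zero => simp
      | succ m => simp only [Nat.add_sub_cancel]; ring
    have h2 : y ^ m * (x - y) ≤ x ^ m * (x - y) :=
      mul_le_mul_of_nonneg_right (pow_le_pow_left₀ hy hxy m) (sub_nonneg.2 hxy)
    simp only [Nat.add_sub_cancel]
    push_cast
    linear_combination h1 + h2

theorem mul_le_pow_sub_pow {x y : ℝ} (hy : 0 ≤ y) (hxy : y ≤ x) (m : ℕ) :
    (m + 1) * y ^ m * (x - y) ≤ x ^ (m + 1) - y ^ (m + 1) := by
  have hx := hy.trans hxy
  induction m with
  | zero => simp
  | succ m ih =>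
    have h1 := mul_le_mul_of_nonneg_left ih hy
    have h2 : y ^ (m + 1) * (x - y) ≤ x ^ (m + 1) * (x - y) :=
      mul_le_mul_of_nonneg_right (pow_le_pow_left₀ hy hxy _) (sub_nonneg.2 hxy)
    push_cast
    linear_combination h1 + h2

/-- A sequence whose increments with step `h` are `O(m N ^ (m - 1))` is `O(N ^ m)`. -/
theorem exists_bound_of_increments {D : ℕ → ℝ} {P : ℕ → Prop} {h m : ℕ} {c : ℝ} (hh : 0 < h)
    (hc : 0 ≤ c) (hP : ∀ N, h ≤ N → P N → P (N - h))
    (hD : ∀ N, h ≤ N → P N → |D N - D (N - h)| ≤ c * (m * ((N : ℝ) + 1) ^ (m - 1))) :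
    ∃ C : ℝ, 0 ≤ C ∧ ∀ N, P N →
      |D N| ≤ C * (((m + 1 : ℕ) : ℝ) * ((N : ℝ) + 1) ^ (m + 1 - 1)) := by
  set K := ∑ i ∈ Finset.range h, |D i|
  have hK0 : 0 ≤ K := Finset.sum_nonneg fun _ _ => abs_nonneg _
  have key : ∀ N : ℕ, P N → |D N| ≤ K + N * (c * (m * ((N : ℝ) + 1) ^ (m - 1))) := by
    intro N
    induction N using Nat.strong_induction_on with
    | _ N ih =>
      intro hN
      rcases lt_or_ge N h with hlt | hge
      · have h1 : |D N| ≤ K := Finset.single_le_sum (f := fun i => |D i|)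
          (fun _ _ => abs_nonneg _) (Finset.mem_range.2 hlt)
        have : 0 ≤ N * (c * (m * ((N : ℝ) + 1) ^ (m - 1))) := by positivity
        linarith
      · have h1 := ih (N - h) (by omega) (hP N hge hN)
        have h2 := hD N hge hN
        have h3 : ((N - h : ℕ) : ℝ) + 1 ≤ N := by
          have : N - h + 1 ≤ N := by omega
          exact_mod_cast this
        have h4 : c * (m * (((N - h : ℕ) : ℝ) + 1) ^ (m - 1)) ≤
            c * (m * ((N : ℝ) + 1) ^ (m - 1)) := by
          gcongr
          omega
        have h5 : 0 ≤ c * (m * ((N : ℝ) + 1) ^ (m - 1)) := by positivity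
        have h6 := abs_add_le (D N - D (N - h)) (D (N - h))
        rw [sub_add_cancel] at h6
        have h7 := mul_le_mul_of_nonneg_left h4 (Nat.cast_nonneg (α := ℝ) (N - h))
        have h8 := mul_le_mul_of_nonneg_right h3 h5
        linarith
  refine ⟨K + c * m, by positivity, fun N hN => (key N hN).trans ?_⟩
  have h1 : (N : ℝ) * (c * (m * ((N : ℝ) + 1) ^ (m - 1))) ≤ c * m * ((N : ℝ) + 1) ^ m := by
    cases m with
    | zero => simp
    | succ m =>
      have : (N : ℝ) * ((N : ℝ) + 1) ^ m ≤ ((N : ℝ) + 1) ^ (m + 1) := by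
        rw [pow_succ']
        gcongr
        linarith
      have := mul_le_mul_of_nonneg_left this (show 0 ≤ c * ((m + 1 : ℕ) : ℝ) by positivity)
      simp only [Nat.add_sub_cancel]
      linarith
  have h2 : (1 : ℝ) ≤ ((N : ℝ) + 1) ^ m := one_le_pow₀ (by linarith [Nat.cast_nonneg (α := ℝ) N])
  have h3 : K ≤ K * ((N : ℝ) + 1) ^ m := le_mul_of_one_le_right hK0 h2
  have h4 : 0 ≤ (K + c * m) * (m * ((N : ℝ) + 1) ^ m) := by positivity
  simp only [Nat.add_sub_cancel]
  push_cast
  linarith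

/-- Asymptotics of `partitionCount` without the coprimality assumption: on the multiples of the
gcd of the parts, the leading term is multiplied by that gcd. -/
theorem partitionCount_asymptotics (m : ℕ) (a : Fin (m + 1) → ℕ) (ha : ∀ i, 0 < a i) :
    ∃ C : ℝ, 0 ≤ C ∧ ∀ N : ℕ, Finset.univ.gcd a ∣ N →
      |(partitionCount a N : ℝ) -
          (Finset.univ.gcd a : ℕ) / ((∏ i, (a i : ℝ)) * (m.factorial : ℝ)) * (N : ℝ) ^ m| ≤
        C * (m * ((N : ℝ) + 1) ^ (m - 1)) := by
  induction m with
  | zero =>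
    refine ⟨0, le_rfl, fun N hN => ?_⟩
    have hgcd : Finset.univ.gcd a = a 0 := by simp
    rw [hgcd] at hN ⊢
    have h0 : (a 0 : ℝ) ≠ 0 := by exact_mod_cast (ha 0).ne'
    rw [partitionCount_one a (ha 0) hN]
    simp [h0]
  | succ m ih =>
    obtain ⟨C, hC, ih⟩ := ih (Fin.tail a) fun i => ha i.succ
    rw [gcd_univ_succ, Fin.prod_univ_succ]
    have hdpos : 0 < Finset.univ.gcd (Fin.tail a) :=
      Nat.pos_of_dvd_of_pos (Finset.gcd_dvd (Finset.mem_univ 0)) (ha _)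
    have hA : 0 < ∏ i, (Fin.tail a i : ℝ) :=
      Finset.prod_pos fun i _ => by exact_mod_cast ha i.succ
    have hzero : ∀ N, ¬ Finset.univ.gcd (Fin.tail a) ∣ N → partitionCount (Fin.tail a) N = 0 :=
      fun N => partitionCount_eq_zero _
    rw [show ∏ i : Fin (m + 1), (a i.succ : ℝ) = ∏ i, (Fin.tail a i : ℝ) from rfl]
    set d := Finset.univ.gcd (Fin.tail a)
    set A := ∏ i, (Fin.tail a i : ℝ)
    have hb := ha 0
    have hg : 0 < Nat.gcd (a 0) d := Nat.gcd_pos_of_pos_right _ hdpos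
    set g := Nat.gcd (a 0) d
    set e := d / g
    have hge : g * e = d := Nat.mul_div_cancel' (Nat.gcd_dvd_right _ _)
    have hepos : 0 < e := Nat.pos_of_mul_pos_left (hge ▸ hdpos)
    set α : ℝ := d / (A * (m.factorial : ℝ)) with hα
    set β : ℝ := g / (a 0 * A * ((m + 1).factorial : ℝ)) with hβ
    have hα0 : 0 ≤ α := by positivity
    have hβ0 : 0 ≤ β := by positivity
    have hαβ : β * ((m + 1) * (a 0 * e : ℕ)) = α := by
      rw [hα, hβ, ← hge, Nat.factorial_succ]
      have : (a 0 : ℝ) ≠ 0 := by exact_mod_cast hb.ne'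
      push_cast
      field_simp
    refine exists_bound_of_increments (D := fun N => (partitionCount a N : ℝ) - β * N ^ (m + 1))
      (P := fun N => g ∣ N) (h := a 0 * e) (c := C + α * (a 0 * e : ℕ)) (Nat.mul_pos hb hepos)
      (by positivity) ?_ ?_
    · exact fun N _ hN => Nat.dvd_sub hN ((Nat.gcd_dvd_left _ _).mul_right e)
    · intro N hle hN
      obtain ⟨k, hk, hdvd, huniq⟩ := existsUnique_dvd_sub_mul hdpos hN hle
      have hrec := partitionCount_sub_mul a ha e hle
      rw [Finset.sum_eq_single_of_mem k (Finset.mem_range.2 hk) fun j hj hjk =>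
        hzero _ fun h => hjk (huniq j (Finset.mem_range.1 hj) h)] at hrec
      have hs : a 0 * k ≤ a 0 * e := Nat.mul_le_mul_left _ hk.le
      have hp := ih _ hdvd
      set s := a 0 * k
      set h := a 0 * e
      have hx : ((N - h : ℕ) : ℝ) = N - h := Nat.cast_sub hle
      have hy0 : (0 : ℝ) ≤ ((N - h : ℕ) : ℝ) := Nat.cast_nonneg _
      have hyx : ((N - h : ℕ) : ℝ) ≤ N := by exact_mod_cast Nat.sub_le _ _
      have hys : ((N - h : ℕ) : ℝ) ≤ ((N - s : ℕ) : ℝ) := by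
        exact_mod_cast Nat.sub_le_sub_left hs N
      have hsx : ((N - s : ℕ) : ℝ) ≤ N := by exact_mod_cast Nat.sub_le _ _
      have hsub : (N : ℝ) - ((N - h : ℕ) : ℝ) = h := by rw [hx]; ring
      have lower := mul_le_mul_of_nonneg_left (mul_le_pow_sub_pow hy0 hyx m) hβ0
      have upper := mul_le_mul_of_nonneg_left (pow_sub_pow_le_mul hy0 hyx (m + 1)) hβ0
      have width := mul_le_mul_of_nonneg_left (pow_sub_pow_le_mul hy0 hyx m) hα0
      rw [hsub] at lower upper width
      have lower' : α * ((N - h : ℕ) : ℝ) ^ m ≤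
          β * ((N : ℝ) ^ (m + 1) - ((N - h : ℕ) : ℝ) ^ (m + 1)) := by
        rw [← hαβ]
        linarith
      have upper' : β * ((N : ℝ) ^ (m + 1) - ((N - h : ℕ) : ℝ) ^ (m + 1)) ≤ α * (N : ℝ) ^ m := by
        rw [← hαβ]
        push_cast [Nat.add_sub_cancel] at upper
        linarith
      have lo : α * ((N - h : ℕ) : ℝ) ^ m ≤ α * ((N - s : ℕ) : ℝ) ^ m := by gcongr
      have up : α * ((N - s : ℕ) : ℝ) ^ m ≤ α * (N : ℝ) ^ m := by gcongr
      have err : C * (m * (((N - s : ℕ) : ℝ) + 1) ^ (m - 1)) ≤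
          C * (m * ((N : ℝ) + 1) ^ (m - 1)) := by gcongr
      have width' : α * (m * (N : ℝ) ^ (m - 1) * h) ≤
          α * h * (m * ((N : ℝ) + 1) ^ (m - 1)) := by
        have : (N : ℝ) ^ (m - 1) ≤ ((N : ℝ) + 1) ^ (m - 1) := by
          gcongr
          linarith
        have := mul_le_mul_of_nonneg_left this (show 0 ≤ α * h * m by positivity)
        linarith
      have hrec' : (partitionCount a N : ℝ) =
          partitionCount a (N - h) + partitionCount (Fin.tail a) (N - s) := by
        exact_mod_cast hrec
      rw [abs_le] at hp ⊢
      constructor <;> linarith [hp.1, hp.2]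

/-- asymptotics of the number of non-negative integer solutions of
`a₁x₁ + ⋯ + aₙxₙ = N` for fixed coprime positive integers `a₁, …, aₙ`. -/
theorem partition_function_asymptotics (n : ℕ) (hn : 2 ≤ n) (a : Fin n → ℕ)
    (hapos : ∀ i, 0 < a i) (hgcd : Finset.univ.gcd a = 1) :
    ∃ c : ℝ, 0 < c ∧ ∀ N : ℕ, 1 ≤ N →
      |((Nat.card {x : Fin n → ℕ // ∑ i, a i * x i = N}) : ℝ) -
          (N : ℝ) ^ (n - 1) / ((∏ i, (a i : ℝ)) * (Nat.factorial (n - 1) : ℝ))| ≤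
        c * (N : ℝ) ^ (n - 2) := by
  obtain ⟨m, rfl⟩ : ∃ m, n = m + 1 + 1 := ⟨n - 2, by omega⟩
  obtain ⟨C, hC, h⟩ := partitionCount_asymptotics (m + 1) a hapos
  refine ⟨C * ((m + 1 : ℕ) * 2 ^ m) + 1, by positivity, fun N hN => ?_⟩
  have hN1 : (1 : ℝ) ≤ N := by exact_mod_cast hN
  have key := h N (by rw [hgcd]; exact one_dvd N)
  rw [hgcd, Nat.cast_one, one_div_mul_eq_div] at key
  refine key.trans ?_
  have h1 : ((N : ℝ) + 1) ^ m ≤ 2 ^ m * (N : ℝ) ^ m := by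
    rw [← mul_pow]
    gcongr
    linarith
  have h2 := mul_le_mul_of_nonneg_left h1 (show 0 ≤ C * ((m + 1 : ℕ) : ℝ) by positivity)
  have h3 : (0 : ℝ) ≤ (N : ℝ) ^ m := by positivity
  simp only [Nat.add_sub_cancel, show m + 1 + 1 - 2 = m by omega]
  linarith
end

section
/- Let D be a square-free positive integer and let (A, B, C) be positive integers satisfying A² + D·B² = C² and gcd(A, C) = 1. Then there exist positive integers D₁, D₂ with D₁·D₂ = D, positive integers u, v with gcd(u, v) = 1 and D₁·u² ≤ D₂·v², and τ ∈ {1, 2}, such that τ·A = D₂·v² − D₁·u², τ·B = 2·u·v, and τ·C = D₁·u² + D₂·v²; moreover, τ = 1 if B is even, and if B is odd then τ = 2 and both u and v are odd. -/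
/-- Coprime naturals whose product is `D * b ^ 2` are, up to complementary factors of `D`,
coprime squares. -/
theorem Nat.Coprime.exists_eq_mul_sq_of_mul_eq_mul_sq {x y D b : ℕ} (hxy : Nat.Coprime x y)
    (hD : 0 < D) (h : x * y = D * b ^ 2) :
    ∃ D₁ D₂ u v : ℕ, D₁ * D₂ = D ∧ u * v = b ∧ x = D₁ * u ^ 2 ∧ y = D₂ * v ^ 2 := by
  have hgcd : D.gcd x * D.gcd y = D := by
    rw [← hxy.gcd_mul D, h, Nat.gcd_mul_right_right]
  obtain ⟨s, hs⟩ := Nat.gcd_dvd_right D x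
  obtain ⟨t, ht⟩ := Nat.gcd_dvd_right D y
  have hst : s * t = b ^ 2 := by
    apply Nat.eq_of_mul_eq_mul_left hD
    rw [← h]
    calc D * (s * t) = (D.gcd x * D.gcd y) * (s * t) := by rw [hgcd]
      _ = (D.gcd x * s) * (D.gcd y * t) := by ring
      _ = x * y := by rw [← hs, ← ht]
  have hcop : Nat.Coprime s t :=
    (hxy.coprime_dvd_left (Dvd.intro_left _ hs.symm)).coprime_dvd_right (Dvd.intro_left _ ht.symm)
  obtain ⟨u, hu⟩ := exists_eq_pow_of_mul_eq_pow (Nat.isUnit_iff.mpr hcop) hst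
  obtain ⟨v, hv⟩ := exists_eq_pow_of_mul_eq_pow (Nat.isUnit_iff.mpr hcop.symm)
    ((mul_comm t s).trans hst)
  refine ⟨D.gcd x, D.gcd y, u, v, hgcd, ?_, by rw [← hu, ← hs], by rw [← hv, ← ht]⟩
  apply Nat.pow_left_injective two_ne_zero
  simp only [mul_pow, ← hu, ← hv, hst]

/-- Positive coprime integers whose product is `D * b ^ 2` are, up to complementary positive factors
of `D`, squares of positive coprime integers. -/
theorem IsCoprime.exists_eq_mul_sq_of_mul_eq_mul_sq {x y b : ℤ} {D : ℕ} (hxy : IsCoprime x y)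
    (hD : 0 < D) (hx : 0 < x) (hy : 0 < y) (hb : 0 < b) (h : x * y = D * b ^ 2) :
    ∃ D₁ D₂ u v : ℤ, 0 < D₁ ∧ 0 < D₂ ∧ D₁ * D₂ = D ∧ 0 < u ∧ 0 < v ∧ Int.gcd u v = 1 ∧
      u * v = b ∧ x = D₁ * u ^ 2 ∧ y = D₂ * v ^ 2 := by
  lift x to ℕ using hx.le
  lift y to ℕ using hy.le
  lift b to ℕ using hb.le
  norm_cast at *
  obtain ⟨D₁, D₂, u, v, rfl, rfl, rfl, rfl⟩ :=
    hxy.exists_eq_mul_sq_of_mul_eq_mul_sq hD h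
  have huv : Nat.Coprime u v :=
    (hxy.coprime_dvd_left (Dvd.intro_left (D₁ * u) (by ring))).coprime_dvd_right
      (Dvd.intro_left (D₂ * v) (by ring))
  refine ⟨D₁, D₂, u, v, ?_, ?_, by push_cast; rfl, ?_, ?_, by simpa using huv,
    by push_cast; rfl, by push_cast; rfl, by push_cast; rfl⟩
  · exact_mod_cast Nat.pos_of_mul_pos_right hD
  · exact_mod_cast Nat.pos_of_mul_pos_left hD
  · exact_mod_cast Nat.pos_of_mul_pos_right hb
  · exact_mod_cast Nat.pos_of_mul_pos_left hb

/-- parametrization of positive primitive solutions of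
`A² + D·B² = C²` for square-free positive `D`. -/
theorem primitive_solution_parametrization (D : ℕ) (hDpos : 0 < D)
    (hDsf : Squarefree D) (A B C : ℤ) (hA : 0 < A) (hB : 0 < B) (hC : 0 < C)
    (heq : A ^ 2 + (D : ℤ) * B ^ 2 = C ^ 2) (hcop : Int.gcd A C = 1) :
    ∃ D₁ D₂ u v τ : ℤ, 0 < D₁ ∧ 0 < D₂ ∧ D₁ * D₂ = (D : ℤ) ∧
      0 < u ∧ 0 < v ∧ Int.gcd u v = 1 ∧ D₁ * u ^ 2 ≤ D₂ * v ^ 2 ∧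
      (τ = 1 ∨ τ = 2) ∧
      τ * A = D₂ * v ^ 2 - D₁ * u ^ 2 ∧
      τ * B = 2 * u * v ∧
      τ * C = D₁ * u ^ 2 + D₂ * v ^ 2 ∧
      (Even B → τ = 1) ∧
      (Odd B → τ = 2 ∧ Odd u ∧ Odd v) := by
  have hAC : IsCoprime A C := Int.isCoprime_iff_gcd_eq_one.mpr hcop
  have hAltC : A < C := by
    have : 0 < (D : ℤ) * B ^ 2 := by positivity
    nlinarith
  rcases Int.even_or_odd B with hBe | hBo
  · obtain ⟨b, rfl⟩ := hBe
    have hpar : Even (C - A) := by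
      have : Even ((C ^ 2 - A ^ 2 : ℤ)) := by
        rw [← heq]; exact ⟨2 * (D : ℤ) * b ^ 2, by ring⟩
      simpa [Int.even_sub, Int.even_pow] using this
    obtain ⟨x, hx⟩ := hpar
    obtain rfl : C = A + (x + x) := by linarith
    have hcop' : IsCoprime x (A + x) := by
      obtain ⟨r, s, hrs⟩ := hAC
      exact ⟨s - r, r + s, by linear_combination hrs⟩
    obtain ⟨D₁, D₂, u, v, h₁, h₂, hD, hu, hv, huv, hb, hxu, hyv⟩ :=
      hcop'.exists_eq_mul_sq_of_mul_eq_mul_sq hDpos (by linarith) (by linarith)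
        (by linarith : 0 < b) (by linarith)
    refine ⟨D₁, D₂, u, v, 1, h₁, h₂, hD, hu, hv, huv, by linarith, Or.inl rfl, by linarith,
      by linear_combination -2 * hb, by linarith, fun _ => rfl, fun h => ?_⟩
    exact absurd ⟨b, rfl⟩ (Int.not_even_iff_odd.mpr h)
  · have hpar : Odd (C - A) := by
      by_contra hne
      obtain ⟨x, hx⟩ := Int.not_odd_iff_even.mp hne
      have hDB : (D : ℤ) * B ^ 2 = 2 ^ 2 * (x * (A + x)) := by
        obtain rfl : C = A + (x + x) := by linarith
        linear_combination heq
      have hBcop : IsCoprime ((2 : ℤ) ^ 2) (B ^ 2) := by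
        have h2 : IsCoprime (2 : ℤ) B := Int.isCoprime_two_left.mpr hBo
        exact h2.pow
      have h4 : (2 * 2 : ℕ) ∣ D := by
        exact_mod_cast hBcop.dvd_of_dvd_mul_right (Dvd.intro _ hDB.symm)
      exact absurd (hDsf 2 h4) (by simp)
    have hcop' : IsCoprime (C - A) (C + A) := by
      have h2 : IsCoprime (C - A) 2 := Int.isCoprime_two_right.mpr hpar
      have hA' : IsCoprime (C - A) A := by
        obtain ⟨r, s, hrs⟩ := hAC
        exact ⟨s, r + s, by linear_combination hrs⟩
      obtain ⟨r, s, hrs⟩ := h2.mul_right hA'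
      exact ⟨r - s, s, by linear_combination hrs⟩
    obtain ⟨D₁, D₂, u, v, h₁, h₂, hD, hu, hv, huv, rfl, hxu, hyv⟩ :=
      hcop'.exists_eq_mul_sq_of_mul_eq_mul_sq hDpos (by linarith) (by linarith)
        hB (by linear_combination -heq)
    exact ⟨D₁, D₂, u, v, 2, h₁, h₂, hD, hu, hv, huv, by linarith, Or.inr rfl, by linarith,
      by ring, by linarith, fun h => absurd h (Int.not_even_iff_odd.mpr hBo),
      fun _ => ⟨rfl, Int.odd_mul.mp hBo⟩⟩
end

section
/- Let n ≥ 1, let S be an invertible symmetric n×n matrix over ℚ, and let T be an n×n matrix over ℚ satisfying Tᵗ·S·T = S. Suppose the characteristic polynomial of T has integer coefficients. Then there exists an invertible n×n matrix g over ℚ such that T' = g⁻¹·T·g has all entries in ℤ and, setting S' = gᵗ·S·g, one has T'ᵗ·S'·T' = S'. -/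
open Module in
/-- An endomorphism integral over `R` stabilizes some `R`-lattice. -/
theorem Module.End.exists_isLattice_of_isIntegral {R K V : Type*} [CommRing R] [Field K]
    [Algebra R K] [AddCommGroup V] [Module K V] [Module R V] [IsScalarTower R K V]
    [FiniteDimensional K V] {f : End K V} (hf : IsIntegral R f) :
    ∃ M : Submodule R V, M.IsLattice K ∧ ∀ x ∈ M, f x ∈ M := by
  let b := Module.finBasis K V
  let ev (j : Fin (finrank K V)) : End K V →ₗ[R] V :=
    (LinearMap.applyₗ (R := K) (b j)).restrictScalars R
  let N := Subalgebra.toSubmodule (Algebra.adjoin R {f})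
  refine ⟨⨆ j, N.map (ev j), ⟨Submodule.fg_iSup _ fun j => hf.fg_adjoin_singleton.map _, ?_⟩,
    fun x hx => ?_⟩
  · rw [eq_top_iff, ← b.span_eq]
    refine Submodule.span_mono ?_
    rintro _ ⟨j, rfl⟩
    exact Submodule.mem_iSup_of_mem j ⟨1, one_mem (Algebra.adjoin R {f}), rfl⟩
  · have h : (⨆ j, N.map (ev j)) ≤ (⨆ j, N.map (ev j)).comap (f.restrictScalars R) := by
      refine iSup_le fun j => ?_
      rintro _ ⟨a, ha, rfl⟩
      exact Submodule.mem_iSup_of_mem j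
        ⟨f * a, (Algebra.adjoin R {f}).mul_mem (Algebra.self_mem_adjoin_singleton R f) ha, rfl⟩
    exact h hx

/-- A matrix over the fraction field `K` of a principal ideal domain `R` which is integral over `R`
is conjugate over `K` to a matrix with entries in `R`. -/
theorem Matrix.exists_conj_eq_map_of_isIntegral {R K ι : Type*} [CommRing R] [IsDomain R]
    [IsPrincipalIdealRing R] [Field K] [Algebra R K] [IsFractionRing R K] [Fintype ι]
    [DecidableEq ι] {A : Matrix ι ι K} (hA : IsIntegral R A) :
    ∃ (g : Matrix ι ι K) (B : Matrix ι ι R), IsUnit g.det ∧ g⁻¹ * A * g = B.map (algebraMap R K) := by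
  obtain ⟨M, hM, hfM⟩ := Module.End.exists_isLattice_of_isIntegral (K := K)
    (hA.map ((Matrix.toLinAlgEquiv' (R := K) (n := ι)).toAlgHom.restrictScalars R))
  have : Module.Free R M := Submodule.IsLattice.free K M
  have hrank := Submodule.IsLattice.finrank_of_pi K M
  let c : Module.Basis ι R M := (Module.finBasisOfFinrankEq R M hrank).reindex
    (Fintype.equivFin ι).symm
  let d := c.extendOfIsLattice K
  let e := Pi.basisFun K ι
  let f' : M →ₗ[R] M := (A.toLin'.restrictScalars R).restrict hfM
  have hinv : e.toMatrix d * d.toMatrix e = 1 := e.toMatrix_mul_toMatrix_flip d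
  refine ⟨e.toMatrix d, LinearMap.toMatrix c c f', ?_, ?_⟩
  · exact (Matrix.isUnit_iff_isUnit_det _).mp (IsUnit.of_mul_eq_one _ hinv)
  · rw [Matrix.inv_eq_right_inv hinv]
    have hAe : A = LinearMap.toMatrix e e A.toLin' := (LinearMap.toMatrix'_toLin' A).symm
    conv_lhs => rw [hAe]
    rw [basis_toMatrix_mul_linearMap_toMatrix_mul_basis_toMatrix]
    ext i j
    have key : A.toLin' (d j) = ∑ k, algebraMap R K (LinearMap.toMatrix c c f' k j) • d k := by
      have h := congrArg (Submodule.subtype M) (c.sum_repr (f' (c j)))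
      simp only [map_sum, map_smul] at h
      simp only [algebraMap_smul, LinearMap.toMatrix_apply, d,
        Module.Basis.extendOfIsLattice_apply]
      exact h.symm
    rw [LinearMap.toMatrix_apply, key, d.repr_sum_self, Matrix.map_apply]

/-- A matrix over `K` is integral over `R` if its characteristic polynomial has coefficients
in `R`. -/
theorem Matrix.isIntegral_of_charpoly_coeff {R K ι : Type*} [CommRing R] [CommRing K] [Algebra R K]
    [Fintype ι] [DecidableEq ι] {A : Matrix ι ι K}
    (hA : ∀ k, A.charpoly.coeff k ∈ (algebraMap R K).range) : IsIntegral R A := by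
  obtain ⟨p, hp, -, hmonic⟩ := Polynomial.lifts_and_natDegree_eq_and_monic
    ((Polynomial.lifts_iff_coeff_lifts _).mpr hA) A.charpoly_monic
  refine ⟨p, hmonic, ?_⟩
  rw [← Polynomial.aeval_def, ← Polynomial.aeval_map_algebraMap K, hp, A.aeval_self_charpoly]

/-- a rational isometry of a nondegenerate rational symmetric
bilinear form whose characteristic polynomial has integer coefficients is
conjugate (over `ℚ`) to an integral matrix, which is an isometry of the
transformed form. -/
theorem rational_isometry_conjugate_integral (n : ℕ) (hn : 1 ≤ n)
    (S T : Matrix (Fin n) (Fin n) ℚ) (hSsymm : S.transpose = S)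
    (hSinv : IsUnit S.det) (hT : T.transpose * S * T = S)
    (hchar : ∀ k, ∃ z : ℤ, (Matrix.charpoly T).coeff k = (z : ℚ)) :
    ∃ g : Matrix (Fin n) (Fin n) ℚ, IsUnit g.det ∧
      (∀ i j, ∃ z : ℤ, (g⁻¹ * T * g) i j = (z : ℚ)) ∧
      (g⁻¹ * T * g).transpose * (g.transpose * S * g) * (g⁻¹ * T * g) =
        g.transpose * S * g := by
  have hint : IsIntegral ℤ T := Matrix.isIntegral_of_charpoly_coeff fun k =>
    let ⟨z, hz⟩ := hchar k
    ⟨z, hz.symm⟩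
  obtain ⟨g, B, hg, hB⟩ := Matrix.exists_conj_eq_map_of_isIntegral hint
  refine ⟨g, hg, fun i j => ⟨B i j, by simp [hB]⟩, ?_⟩
  have hconj : g * (g⁻¹ * T * g) = T * g := by
    rw [Matrix.mul_assoc, Matrix.mul_nonsing_inv_cancel_left _ _ hg]
  calc (g⁻¹ * T * g).transpose * (g.transpose * S * g) * (g⁻¹ * T * g)
      = (g * (g⁻¹ * T * g)).transpose * S * (g * (g⁻¹ * T * g)) := by
        rw [Matrix.transpose_mul g]; simp only [Matrix.mul_assoc]
    _ = g.transpose * (T.transpose * S * T) * g := by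
        rw [hconj, Matrix.transpose_mul]; simp only [Matrix.mul_assoc]
    _ = g.transpose * S * g := by rw [hT]
end
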